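/- arXiv:2409.11288 — 10 statements merged into one kernel-verified Lean document; each statement's English description precedes it below -/
import Mathlib

section
/- The following are equivalent: (i) for every c ∈ ℝ^m with c > 0 componentwise, the set Y_c = {y ∈ P : y^H = c^H} has exactly one element; (ii) the map f is a bijection from ℝ^{d_P} onto {z ∈ ℝ^d : z_i > 0 for all i}. -/
/-- If `y` is in the interior, relative to the directions in `T`, of the convex hull of the points
`v k`, then `y` is an exponentially weighted barycentre of these points. -/
theorem exists_sum_exp_smul_sub_eq_zero {ι κ : Type*} [Fintype ι] [Fintype κ]
    (v : κ → ι → ℝ) (T : Submodule ℝ (ι → ℝ)) (y : ι → ℝ) (δ : ℝ) (hδ : 0 < δ)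
    (hball : ∀ t ∈ T, ‖t‖ ≤ δ → y + t ∈ convexHull ℝ (Set.range v))
    (hvT : ∀ k, v k - y ∈ T) :
    ∃ u ∈ T, ∑ k, Real.exp (v k ⬝ᵥ u) • (v k - y) = 0 := by
  let F : T → ℝ := fun t => ∑ k, Real.exp ((v k - y) ⬝ᵥ (t : ι → ℝ))
  have hcont : Continuous F := by
    have h (k : κ) : Continuous fun t : T => (v k - y) ⬝ᵥ (t : ι → ℝ) :=
      Continuous.dotProduct continuous_const continuous_subtype_val
    exact continuous_finsetSum _ fun k _ => Real.continuous_exp.comp (h k)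
  have hlow (t : T) : δ * ‖t‖ ≤ F t := by
    have hF0 : 0 ≤ F t := Finset.sum_nonneg fun k _ => (Real.exp_pos _).le
    rcases eq_or_ne t 0 with rfl | ht
    · simpa using hF0
    have hnt : 0 < ‖(t : ι → ℝ)‖ := by simpa using ht
    have hmem := hball ((δ / ‖(t : ι → ℝ)‖) • (t : ι → ℝ)) (T.smul_mem _ t.2) (by
      rw [norm_smul, Real.norm_eq_abs, abs_of_pos (by positivity), div_mul_cancel₀ _ hnt.ne'])
    obtain ⟨k, hk⟩ : ∃ k, δ * ‖t‖ ≤ (v k - y) ⬝ᵥ (t : ι → ℝ) := by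
      by_contra! hcon
      have hsub : convexHull ℝ (Set.range v) ⊆
          {x | x ⬝ᵥ (t : ι → ℝ) < δ * ‖t‖ + y ⬝ᵥ (t : ι → ℝ)} := by
        refine convexHull_min ?_ (convex_halfSpace_lt
          ⟨fun a b => add_dotProduct a b _, fun c a => smul_dotProduct c a _⟩ _)
        rintro _ ⟨k, rfl⟩
        have := hcon k
        rw [sub_dotProduct] at this
        show v k ⬝ᵥ (t : ι → ℝ) < δ * ‖t‖ + y ⬝ᵥ (t : ι → ℝ)
        linarith
      have h1 : (y + (δ / ‖(t : ι → ℝ)‖) • (t : ι → ℝ)) ⬝ᵥ (t : ι → ℝ) <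
          δ * ‖t‖ + y ⬝ᵥ (t : ι → ℝ) := hsub hmem
      have h2 : ‖(t : ι → ℝ)‖ * ‖(t : ι → ℝ)‖ ≤ (t : ι → ℝ) ⬝ᵥ (t : ι → ℝ) := by
        have h3 : ‖(t : ι → ℝ)‖ ≤ √((t : ι → ℝ) ⬝ᵥ (t : ι → ℝ)) := by
          refine (pi_norm_le_iff_of_nonneg (Real.sqrt_nonneg _)).2 fun j => ?_
          rw [Real.norm_eq_abs]
          refine Real.abs_le_sqrt ?_
          rw [dotProduct, sq]
          exact Finset.single_le_sum (f := fun i => (t : ι → ℝ) i * (t : ι → ℝ) i)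
            (fun i _ => mul_self_nonneg _) (Finset.mem_univ j)
        have h4 : 0 ≤ (t : ι → ℝ) ⬝ᵥ (t : ι → ℝ) :=
          Finset.sum_nonneg fun i _ => mul_self_nonneg _
        calc _ ≤ _ := mul_le_mul h3 h3 (norm_nonneg _) (Real.sqrt_nonneg _)
          _ = _ := Real.mul_self_sqrt h4
      rw [add_dotProduct, smul_dotProduct, smul_eq_mul] at h1
      have h5 : δ * ‖t‖ ≤ δ / ‖(t : ι → ℝ)‖ * ((t : ι → ℝ) ⬝ᵥ (t : ι → ℝ)) := by
        calc δ * ‖t‖ = δ / ‖(t : ι → ℝ)‖ * (‖(t : ι → ℝ)‖ * ‖(t : ι → ℝ)‖) := by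
              rw [Submodule.norm_coe]
              field_simp [show ‖t‖ ≠ 0 by simpa using ht]
          _ ≤ _ := mul_le_mul_of_nonneg_left h2 (by positivity)
      linarith
    calc δ * ‖t‖ ≤ Real.exp ((v k - y) ⬝ᵥ (t : ι → ℝ)) := by
          linarith [Real.add_one_le_exp ((v k - y) ⬝ᵥ (t : ι → ℝ))]
      _ ≤ F t := Finset.single_le_sum
          (f := fun k => Real.exp ((v k - y) ⬝ᵥ (t : ι → ℝ)))
          (fun i _ => (Real.exp_pos _).le) (Finset.mem_univ k)
  have htend : Filter.Tendsto F (Filter.cocompact T) Filter.atTop :=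
    Filter.tendsto_atTop_mono hlow
      ((tendsto_norm_cocompact_atTop (E := T)).const_mul_atTop hδ)
  obtain ⟨u, hu⟩ := hcont.exists_forall_le htend
  refine ⟨u, u.2, ?_⟩
  set s : ι → ℝ := ∑ k, Real.exp ((v k - y) ⬝ᵥ (u : ι → ℝ)) • (v k - y) with hs
  have hsT : s ∈ T := T.sum_mem fun k _ => T.smul_mem _ (hvT k)
  have hder : HasDerivAt (fun r : ℝ => F (u + r • (⟨s, hsT⟩ : T)))
      (∑ k, Real.exp ((v k - y) ⬝ᵥ (u : ι → ℝ)) * ((v k - y) ⬝ᵥ s)) 0 := by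
    have h (k : κ) : HasDerivAt
        (fun r : ℝ => Real.exp ((v k - y) ⬝ᵥ (u : ι → ℝ) + r * ((v k - y) ⬝ᵥ s)))
        (Real.exp ((v k - y) ⬝ᵥ (u : ι → ℝ)) * ((v k - y) ⬝ᵥ s)) 0 := by
      have := (((hasDerivAt_id (0 : ℝ)).mul_const ((v k - y) ⬝ᵥ s)).const_add
        ((v k - y) ⬝ᵥ (u : ι → ℝ))).exp
      simpa using this
    have h' := HasDerivAt.fun_sum (u := Finset.univ) fun k _ => h k
    refine h'.congr_of_eventuallyEq (Filter.Eventually.of_forall fun r => ?_)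
    simp only [F, Submodule.coe_add, Submodule.coe_smul, dotProduct_add, dotProduct_smul, smul_eq_mul]
  have hmin : IsLocalMin (fun r : ℝ => F (u + r • (⟨s, hsT⟩ : T))) 0 :=
    Filter.Eventually.of_forall fun r => by simpa using hu (u + r • (⟨s, hsT⟩ : T))
  have hzero := hmin.hasDerivAt_eq_zero hder
  have hss : s ⬝ᵥ s = 0 := by
    rw [← hzero]
    nth_rewrite 1 [hs]
    rw [sum_dotProduct]
    simp_rw [smul_dotProduct, smul_eq_mul]
  have hs0 : s = 0 := dotProduct_self_eq_zero.1 hss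
  have : ∑ k, Real.exp (v k ⬝ᵥ (u : ι → ℝ)) • (v k - y) =
      Real.exp (y ⬝ᵥ (u : ι → ℝ)) • s := by
    rw [hs, Finset.smul_sum]
    refine Finset.sum_congr rfl fun k _ => ?_
    rw [smul_smul, ← Real.exp_add, sub_dotProduct, add_sub_cancel]
  rw [this, hs0, smul_zero]

/-- The exponential weights representing a relatively interior point of the convex hull of the
points `v k` are determined by their direction in `T`. -/
theorem eq_of_sum_exp_smul_sub_eq_zero {ι κ : Type*} [Fintype ι] [Fintype κ]
    (v : κ → ι → ℝ) (T : Submodule ℝ (ι → ℝ)) (y : ι → ℝ) (δ : ℝ) (hδ : 0 < δ)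
    (hball : ∀ t ∈ T, ‖t‖ ≤ δ → y + t ∈ convexHull ℝ (Set.range v))
    {u w : ι → ℝ} (hu : u ∈ T) (hw : w ∈ T)
    (hu0 : ∑ k, Real.exp (v k ⬝ᵥ u) • (v k - y) = 0)
    (hw0 : ∑ k, Real.exp (v k ⬝ᵥ w) • (v k - y) = 0) : u = w := by
  have key (x : ι → ℝ) (hx : ∑ k, Real.exp (v k ⬝ᵥ x) • (v k - y) = 0) :
      ∑ k, Real.exp ((v k - y) ⬝ᵥ x) * ((v k - y) ⬝ᵥ (u - w)) = 0 := by
    have h : (Real.exp (-(y ⬝ᵥ x)) • ∑ k, Real.exp (v k ⬝ᵥ x) • (v k - y)) ⬝ᵥ (u - w) = 0 := by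
      rw [hx, smul_zero, zero_dotProduct]
    rw [Finset.smul_sum, sum_dotProduct] at h
    rw [← h]
    refine Finset.sum_congr rfl fun k _ => ?_
    rw [smul_smul, ← Real.exp_add, smul_dotProduct, smul_eq_mul, sub_dotProduct (v k) y x,
      neg_add_eq_sub]
  have hsum : ∑ k, (Real.exp ((v k - y) ⬝ᵥ u) - Real.exp ((v k - y) ⬝ᵥ w)) *
      ((v k - y) ⬝ᵥ u - (v k - y) ⬝ᵥ w) = 0 := by
    simp_rw [← dotProduct_sub, sub_mul, Finset.sum_sub_distrib]
    rw [key u hu0, key w hw0, sub_zero]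
  have hnonneg (a b : ℝ) : 0 ≤ (Real.exp a - Real.exp b) * (a - b) := by
    rcases le_total a b with h | h
    · exact mul_nonneg_of_nonpos_of_nonpos (by simpa using h) (by simpa using h)
    · exact mul_nonneg (by simpa using h) (by simpa using h)
  have heq (k : κ) : (v k) ⬝ᵥ (u - w) = y ⬝ᵥ (u - w) := by
    have h := (Finset.sum_eq_zero_iff_of_nonneg fun k _ => hnonneg _ _).1 hsum k
      (Finset.mem_univ k)
    have h' : (v k - y) ⬝ᵥ u = (v k - y) ⬝ᵥ w := by
      rcases mul_eq_zero.1 h with h | h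
      · exact Real.exp_injective (sub_eq_zero.1 h)
      · exact sub_eq_zero.1 h
    rw [← sub_eq_zero, ← sub_dotProduct, dotProduct_sub, h', sub_self]
  have hsub : convexHull ℝ (Set.range v) ⊆ {x | x ⬝ᵥ (u - w) = y ⬝ᵥ (u - w)} := by
    refine convexHull_min ?_ (convex_hyperplane
      ⟨fun a b => add_dotProduct a b _, fun c a => smul_dotProduct c a _⟩ _)
    rintro _ ⟨k, rfl⟩
    exact heq k
  by_contra hne
  have hpos : 0 < ‖u - w‖ := norm_pos_iff.2 (sub_ne_zero.2 hne)
  have hmem := hsub (hball ((δ / ‖u - w‖) • (u - w)) (T.smul_mem _ (T.sub_mem hu hw)) (by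
    rw [norm_smul, Real.norm_eq_abs, abs_of_pos (by positivity), div_mul_cancel₀ _ hpos.ne']))
  rw [Set.mem_ofPred_eq, add_dotProduct, smul_dotProduct, add_eq_left, smul_eq_mul] at hmem
  rcases mul_eq_zero.1 hmem with h | h
  · exact (div_pos hδ hpos).ne' h
  · exact hne (sub_eq_zero.1 (dotProduct_self_eq_zero.1 h))

/-- The set of nonnegative vectors of total mass one in the kernel of `A` is the convex hull of its
extreme points. -/
theorem convexHull_eq_of_range_eq_extremePoints {ι κ ν : Type*} [Fintype ι] [Finite κ]
    (A : Matrix ν ι ℝ) (v : κ → ι → ℝ)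
    (hv : Set.range v = Set.extremePoints ℝ
      {y : ι → ℝ | A.mulVec y = 0 ∧ (∀ j, 0 ≤ y j) ∧ ∑ j, y j = 1}) :
    convexHull ℝ (Set.range v) = {y : ι → ℝ | A.mulVec y = 0 ∧ (∀ j, 0 ≤ y j) ∧ ∑ j, y j = 1} := by
  have hset : {y : ι → ℝ | A.mulVec y = 0 ∧ (∀ j, 0 ≤ y j) ∧ ∑ j, y j = 1} =
      stdSimplex ℝ ι ∩ (LinearMap.ker A.mulVecLin : Set (ι → ℝ)) := by
    ext y
    simp [stdSimplex, and_comm]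
  have hcomp : IsCompact {y : ι → ℝ | A.mulVec y = 0 ∧ (∀ j, 0 ≤ y j) ∧ ∑ j, y j = 1} := by
    rw [hset]
    exact (isCompact_stdSimplex ℝ ι).inter_right (Submodule.closed_of_finiteDimensional _)
  have hconv : Convex ℝ {y : ι → ℝ | A.mulVec y = 0 ∧ (∀ j, 0 ≤ y j) ∧ ∑ j, y j = 1} := by
    rw [hset]
    exact (convex_stdSimplex ℝ ι).inter (Submodule.convex _)
  have h := closure_convexHull_extremePoints hcomp hconv
  rwa [← hv, ((Set.finite_range v).isClosed_convexHull ℝ).closure_eq] at h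

/-- A monomial map whose exponent matrix has linearly independent columns maps the open positive
orthant onto the open positive orthant. -/
theorem exists_pos_forall_prod_rpow_eq {ι κ : Type*} [Fintype ι] [Fintype κ] (H : Matrix ι κ ℝ)
    (hH : LinearIndependent ℝ (fun i : κ => fun j => H j i)) (z : κ → ℝ) (hz : ∀ i, 0 < z i) :
    ∃ c : ι → ℝ, (∀ j, 0 < c j) ∧ (fun i => ∏ j, Real.rpow (c j) (H j i)) = z := by
  have hrank : H.transpose.rank = Fintype.card κ := LinearIndependent.rank_matrix hH
  have hsurj : Function.Surjective H.transpose.mulVecLin := by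
    rw [← LinearMap.range_eq_top]
    apply Submodule.eq_top_of_finrank_eq
    rw [Module.finrank_fintype_fun_eq_card]
    exact hrank
  obtain ⟨x, hx⟩ := hsurj fun i => Real.log (z i)
  refine ⟨fun j => Real.exp (x j), fun j => Real.exp_pos _, funext fun i => ?_⟩
  have hxi : ∑ j, x j * H j i = Real.log (z i) := by
    rw [← congrFun hx i]
    exact Finset.sum_congr rfl fun j _ => mul_comm _ _
  calc ∏ j, Real.rpow (Real.exp (x j)) (H j i) = ∏ j, Real.exp (x j * H j i) :=
        Finset.prod_congr rfl fun j _ => (Real.exp_mul (x j) (H j i)).symm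
    _ = z i := by rw [← Real.exp_sum, hxi, Real.exp_log (hz i)]


/-- unique solution on the coefficient polytope for all positive parameters iff the moment/power map f is a bijection onto the positive orthant. -/
theorem unique_solution_iff_bijective
    (l m n dP d nP : ℕ)
    (A : Matrix (Fin l) (Fin m) ℝ) (B : Matrix (Fin n) (Fin m) ℝ)
    (T D : Submodule ℝ (Fin m → ℝ))
    (hT : ∀ y : Fin m → ℝ, y ∈ T ↔ (A.mulVec y = 0 ∧ ∑ j, y j = 0))
    (hD : ∀ y : Fin m → ℝ, y ∈ D ↔ (B.mulVec y = 0 ∧ ∑ j, y j = 0))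
    (hdP : Module.finrank ℝ T = dP) (hd : Module.finrank ℝ D = d) (hdPd : dP = d)
    (G : Matrix (Fin m) (Fin dP) ℝ) (H : Matrix (Fin m) (Fin d) ℝ)
    (hGind : LinearIndependent ℝ (fun i : Fin dP => fun j => G j i))
    (hGrange : LinearMap.range G.mulVecLin = T)
    (hHind : LinearIndependent ℝ (fun i : Fin d => fun j => H j i))
    (hHrange : LinearMap.range H.mulVecLin = D)
    (P : Set (Fin m → ℝ))
    (hP : P = {y : Fin m → ℝ | A.mulVec y = 0 ∧ (∀ j, 0 < y j) ∧ ∑ j, y j = 1})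
    (hPne : P.Nonempty)
    (Pbar : Set (Fin m → ℝ))
    (hPbar : Pbar = {y : Fin m → ℝ | A.mulVec y = 0 ∧ (∀ j, 0 ≤ y j) ∧ ∑ j, y j = 1})
    (v : Fin nP → (Fin m → ℝ))
    (hv : Set.range v = Set.extremePoints ℝ Pbar)
    (p : (Fin dP → ℝ) → (Fin m → ℝ))
    (hp : ∀ ξ, p ξ = (∑ k, Real.exp (∑ j, v k j * G.mulVec ξ j))⁻¹ •
        ∑ k, Real.exp (∑ j, v k j * G.mulVec ξ j) • v k)
    (f : (Fin dP → ℝ) → (Fin d → ℝ))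
    (hf : ∀ ξ, f ξ = fun i => ∏ j, Real.rpow (p ξ j) (H j i))
    :
    (∀ c : Fin m → ℝ, (∀ j, 0 < c j) →
      ∃! y : Fin m → ℝ, y ∈ P ∧
        (fun i => ∏ j, Real.rpow (y j) (H j i)) = (fun i => ∏ j, Real.rpow (c j) (H j i))) ↔
    Set.BijOn f Set.univ {z : Fin d → ℝ | ∀ i, 0 < z i} := by
  have hhull := convexHull_eq_of_range_eq_extremePoints A v (by rw [hv, hPbar])
  have hvmem (k : Fin nP) : A.mulVec (v k) = 0 ∧ (∀ j, 0 ≤ v k j) ∧ ∑ j, v k j = 1 := by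
    have h := subset_convexHull ℝ _ (Set.mem_range_self (f := v) k)
    rwa [hhull] at h
  have hvT (y : Fin m → ℝ) (hy : y ∈ P) (k : Fin nP) : v k - y ∈ T := by
    rw [hP] at hy
    rw [hT, Matrix.mulVec_sub, (hvmem k).1, hy.1]
    simp [(hvmem k).2.2, hy.2.2]
  have hball (y : Fin m → ℝ) (hy : y ∈ P) :
      ∃ δ > 0, ∀ t ∈ T, ‖t‖ ≤ δ → y + t ∈ convexHull ℝ (Set.range v) := by
    rw [hP] at hy
    obtain ⟨δ, hδ, hδy⟩ : ∃ δ > 0, ∀ j, δ ≤ y j := by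
      rcases isEmpty_or_nonempty (Fin m) with h | h
      · exact ⟨1, one_pos, fun j => h.elim j⟩
      · obtain ⟨j, hj⟩ := Finite.exists_min y
        exact ⟨y j, hy.2.1 j, hj⟩
    refine ⟨δ, hδ, fun t ht htδ => ?_⟩
    rw [hT] at ht
    rw [hhull]
    refine ⟨by rw [Matrix.mulVec_add, hy.1, ht.1, add_zero], fun j => ?_, ?_⟩
    · have h := abs_le.1 ((norm_le_pi_norm t j).trans htδ)
      have := hδy j
      show 0 ≤ y j + t j
      linarith
    · simp [Finset.sum_add_distrib, hy.2.2, ht.2]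
  have hGinj : Function.Injective G.mulVec := Matrix.mulVec_injective_iff.2 hGind
  have hGT (ξ : Fin dP → ℝ) : G.mulVec ξ ∈ T := by
    rw [← hGrange]
    exact ⟨ξ, rfl⟩
  obtain ⟨y₀, hy₀⟩ := hPne
  have hy₀hull : y₀ ∈ convexHull ℝ (Set.range v) := by
    rw [hP] at hy₀
    rw [hhull]
    exact ⟨hy₀.1, fun j => (hy₀.2.1 j).le, hy₀.2.2⟩
  have hne : Nonempty (Fin nP) := by
    rw [← Set.range_nonempty_iff_nonempty (f := v), ← convexHull_nonempty_iff (𝕜 := ℝ)]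
    exact ⟨y₀, hy₀hull⟩
  have hwpos (ξ : Fin dP → ℝ) : 0 < ∑ k, Real.exp (∑ j, v k j * G.mulVec ξ j) :=
    Finset.sum_pos (fun k _ => Real.exp_pos _) Finset.univ_nonempty
  have hpP (ξ : Fin dP → ℝ) : p ξ ∈ P := by
    have hpos (j : Fin m) : ∃ k, 0 < v k j := by
      by_contra! hcon
      have hsub : convexHull ℝ (Set.range v) ⊆ {x | x j ≤ 0} := by
        refine convexHull_min ?_ (convex_halfSpace_le
          ⟨fun a b => rfl, fun c a => rfl⟩ _)
        rintro _ ⟨k, rfl⟩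
        exact hcon k
      have h1 : y₀ j ≤ 0 := hsub hy₀hull
      rw [hP] at hy₀
      exact absurd (hy₀.2.1 j) h1.not_gt
    rw [hP, hp]
    refine ⟨?_, fun j => ?_, ?_⟩
    · rw [Matrix.mulVec_smul, Matrix.mulVec_sum]
      simp [Matrix.mulVec_smul, (hvmem _).1]
    · rw [Pi.smul_apply, Finset.sum_apply, smul_eq_mul]
      obtain ⟨k, hk⟩ := hpos j
      refine mul_pos (inv_pos.2 (hwpos ξ)) (Finset.sum_pos' (fun i _ => ?_)
        ⟨k, Finset.mem_univ k, ?_⟩)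
      · exact mul_nonneg (Real.exp_pos _).le ((hvmem i).2.1 j)
      · exact mul_pos (Real.exp_pos _) hk
    · simp only [Pi.smul_apply, Finset.sum_apply, smul_eq_mul]
      rw [← Finset.mul_sum, Finset.sum_comm]
      simp_rw [← Finset.mul_sum, (hvmem _).2.2, mul_one]
      exact inv_mul_cancel₀ (hwpos ξ).ne'
  have hp_iff (ξ : Fin dP → ℝ) (y : Fin m → ℝ) :
      p ξ = y ↔ ∑ k, Real.exp (v k ⬝ᵥ G.mulVec ξ) • (v k - y) = 0 := by
    rw [hp, inv_smul_eq_iff₀ (hwpos ξ).ne', ← sub_eq_zero, Finset.sum_smul,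
      ← Finset.sum_sub_distrib]
    simp_rw [← smul_sub]
    rfl
  have hpbij : Set.BijOn p Set.univ P := by
    refine ⟨fun ξ _ => hpP ξ, fun ξ _ η _ h => ?_, fun y hy => ?_⟩
    · obtain ⟨δ, hδ, hb⟩ := hball (p η) (hpP η)
      exact hGinj (eq_of_sum_exp_smul_sub_eq_zero v T (p η) δ hδ hb (hGT ξ) (hGT η)
        ((hp_iff ξ _).1 h) ((hp_iff η _).1 rfl))
    · obtain ⟨δ, hδ, hb⟩ := hball y hy
      obtain ⟨u, hu, hu0⟩ := exists_sum_exp_smul_sub_eq_zero v T y δ hδ hb (hvT y hy)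
      rw [← hGrange] at hu
      obtain ⟨ξ, rfl⟩ := hu
      exact ⟨ξ, Set.mem_univ _, (hp_iff ξ y).2 hu0⟩
  have hqpos (c : Fin m → ℝ) (hc : ∀ j, 0 < c j) (i : Fin d) :
      0 < ∏ j, Real.rpow (c j) (H j i) :=
    Finset.prod_pos fun j _ => Real.rpow_pos_of_pos (hc j) _
  have hPpos (y : Fin m → ℝ) (hy : y ∈ P) (j : Fin m) : 0 < y j := by
    rw [hP] at hy
    exact hy.2.1 j
  constructor
  · intro h
    refine ⟨fun ξ _ => ?_, fun ξ _ η _ hξη => ?_, fun z hz => ?_⟩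
    · rw [hf]
      exact hqpos _ (hPpos _ (hpP ξ))
    · rw [hf, hf] at hξη
      exact hpbij.injOn (Set.mem_univ _) (Set.mem_univ _)
        ((h (p η) (hPpos _ (hpP η))).unique ⟨hpP ξ, hξη⟩ ⟨hpP η, rfl⟩)
    · obtain ⟨c, hc, rfl⟩ := exists_pos_forall_prod_rpow_eq H hHind z hz
      obtain ⟨y, ⟨hy, hyc⟩, -⟩ := h c hc
      obtain ⟨ξ, -, rfl⟩ := hpbij.surjOn hy
      exact ⟨ξ, Set.mem_univ _, by rw [hf, hyc]⟩
  · intro h c hc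
    obtain ⟨ξ, -, hξ⟩ := h.surjOn (show _ ∈ {z : Fin d → ℝ | ∀ i, 0 < z i} from hqpos c hc)
    refine ⟨p ξ, ⟨hpP ξ, by rw [← hξ, hf]⟩, ?_⟩
    rintro y ⟨hy, hyc⟩
    obtain ⟨η, -, rfl⟩ := hpbij.surjOn hy
    rw [h.injOn (Set.mem_univ η) (Set.mem_univ ξ) (by rw [hξ, hf, hyc])]
end

section
/- Let U ⊆ ℝ^n be open and convex, and let f : ℝ^n → U be a C¹ map. Then f is a diffeomorphism onto U (a C¹ bijection with C¹ inverse) if and only if (i) the Jacobian determinant det(J_f(x)) is nonzero for all x ∈ ℝ^n, and (ii) f is proper as a map into U. -/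
/-- A proper local homeomorphism from a nonempty connected Hausdorff space to a simply connected,
locally path connected space is bijective. -/
theorem IsProperMap.bijective_of_isLocalHomeomorph {E X : Type*} [TopologicalSpace E]
    [TopologicalSpace X] [T2Space E] [ConnectedSpace E] [SimplyConnectedSpace X]
    [LocallyPathConnectedSpace X] {p : E → X} (hp : IsProperMap p) (hl : IsLocalHomeomorph p) :
    Function.Bijective p := by
  have hfin : ∀ x ∈ Set.univ, (p ⁻¹' {x}).Finite := fun x _ ↦
    (hp.isCompact_preimage isCompact_singleton).finite <|
      IsDiscrete.of_openPartialHomeomorph p subset_rfl fun e _ ↦ by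
        obtain ⟨φ, he, hφ⟩ := hl e
        exact ⟨φ, he, hφ.symm⟩
  have cov : IsCoveringMap p := isCoveringMap_iff_isCoveringMapOn_univ.mpr <|
    hp.isClosedMap.isCoveringMapOn_of_isLocalHomeomorphOn hfin
      (by simpa using isLocalHomeomorph_iff_isLocalHomeomorphOn_univ.mp hl)
  obtain ⟨e₀⟩ : Nonempty E := inferInstance
  obtain ⟨s, ⟨hs₀, hs⟩, -⟩ :=
    cov.existsUnique_continuousMap_lifts (ContinuousMap.id X) (p e₀) e₀ rfl
  have hright : ∀ x, p (s x) = x := congrFun hs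
  have hleft : s ∘ p = id :=
    cov.eq_of_comp_eq (s.continuous.comp hp.continuous) continuous_id
      (funext fun e ↦ hright (p e)) e₀ hs₀
  exact ⟨Function.LeftInverse.injective (congrFun hleft),
    Function.RightInverse.surjective hright⟩

/-- A continuous map into a set `U` whose preimages of compact subsets of `U` are compact is a
proper map to the subtype `U`. -/
theorem isProperMap_codRestrict {E X : Type*} [TopologicalSpace E] [TopologicalSpace X]
    {U : Set X} [T2Space U] [CompactlyCoherentSpace U] {f : E → X} (hf : Continuous f)
    (hU : ∀ x, f x ∈ U) (h : ∀ K ⊆ U, IsCompact K → IsCompact (f ⁻¹' K)) :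
    IsProperMap (Set.codRestrict f U hU) := by
  refine isProperMap_iff_isCompact_preimage.mpr ⟨hf.codRestrict hU, fun K hK ↦ ?_⟩
  convert! h (Subtype.val '' K) (Subtype.coe_image_subset U K) (hK.image continuous_subtype_val)
  ext x
  simp [hU x, Set.codRestrict]

section InverseFunction

variable {E : Type*} [NormedAddCommGroup E] [NormedSpace ℝ E] [FiniteDimensional ℝ E] {f : E → E}

/-- A `C¹` map with nonvanishing Jacobian determinant is a local homeomorphism. -/
theorem ContDiff.isLocalHomeomorph_of_det_ne_zero (hf : ContDiff ℝ 1 f)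
    (hdet : ∀ x, (fderiv ℝ f x).det ≠ 0) : IsLocalHomeomorph f := by
  have := FiniteDimensional.complete ℝ E
  intro x
  have hx : HasFDerivAt f
      ((fderiv ℝ f x).toContinuousLinearEquivOfDetNeZero (hdet x) : E →L[ℝ] E) x := by
    simpa using (hf.differentiable one_ne_zero x).hasFDerivAt
  exact ⟨hf.contDiffAt.toOpenPartialHomeomorph f hx one_ne_zero,
    hf.contDiffAt.mem_toOpenPartialHomeomorph_source hx one_ne_zero, rfl⟩

/-- A left inverse of a `C¹` map is `C¹` at the image of any point where the Jacobian determinant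
does not vanish. -/
theorem ContDiff.contDiffAt_leftInverse_of_det_ne_zero (hf : ContDiff ℝ 1 f) {g : E → E}
    (hg : Function.LeftInverse g f) {x : E} (hdet : (fderiv ℝ f x).det ≠ 0) :
    ContDiffAt ℝ 1 g (f x) := by
  have := FiniteDimensional.complete ℝ E
  have hx : HasFDerivAt f
      ((fderiv ℝ f x).toContinuousLinearEquivOfDetNeZero hdet : E →L[ℝ] E) x := by
    simpa using (hf.differentiable one_ne_zero x).hasFDerivAt
  refine (hf.contDiffAt.to_localInverse hx one_ne_zero).congr_of_eventuallyEq ?_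
  filter_upwards [(hf.contDiffAt.hasStrictFDerivAt' hx one_ne_zero).eventually_right_inverse]
    with y hy
  rw [← hg (hf.contDiffAt.localInverse hx one_ne_zero y)]
  exact congrArg g hy.symm

end InverseFunction

/-- Hadamard's global inversion theorem for maps into an open convex set:
a C¹ map f : ℝ^n → U is a diffeomorphism onto U iff its Jacobian determinant never
vanishes and f is proper as a map into U. -/
theorem hadamard_global_inversion (n : ℕ) (U : Set (Fin n → ℝ))
    (hUopen : IsOpen U) (hUconv : Convex ℝ U)
    (f : (Fin n → ℝ) → (Fin n → ℝ)) (hf : ContDiff ℝ 1 f) (hrange : ∀ x, f x ∈ U) :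
    (Set.BijOn f Set.univ U ∧
      ∃ g : (Fin n → ℝ) → (Fin n → ℝ),
        (∀ x, g (f x) = x) ∧ (∀ y ∈ U, f (g y) = y) ∧ ContDiffOn ℝ 1 g U) ↔
    ((∀ x, LinearMap.det (fderiv ℝ f x : (Fin n → ℝ) →ₗ[ℝ] (Fin n → ℝ)) ≠ 0) ∧
      (∀ K ⊆ U, IsCompact K → IsCompact (f ⁻¹' K))) := by
  constructor
  · rintro ⟨-, g, hgf, hfg, hg⟩
    refine ⟨fun x ↦ ?_, fun K hKU hK ↦ ?_⟩
    · have hgx : DifferentiableAt ℝ g (f x) :=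
        (hg.differentiableOn one_ne_zero).differentiableAt (hUopen.mem_nhds (hrange x))
      have hcomp : (fderiv ℝ g (f x)).comp (fderiv ℝ f x) = ContinuousLinearMap.id ℝ _ := by
        rw [← fderiv_comp x hgx (hf.differentiable one_ne_zero x),
          show g ∘ f = id from funext hgf, fderiv_id]
      have hlin : (fderiv ℝ g (f x) : (Fin n → ℝ) →ₗ[ℝ] (Fin n → ℝ)) ∘ₗ
          (fderiv ℝ f x : (Fin n → ℝ) →ₗ[ℝ] (Fin n → ℝ)) = LinearMap.id :=
        congrArg ContinuousLinearMap.toLinearMap hcomp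
      have hmul := congrArg LinearMap.det hlin
      rw [LinearMap.det_comp, LinearMap.det_id] at hmul
      exact right_ne_zero_of_mul_eq_one hmul
    · suffices f ⁻¹' K = g '' K from
        this ▸ hK.image_of_continuousOn (hg.continuousOn.mono hKU)
      ext x
      constructor
      · exact fun hx ↦ ⟨f x, hx, hgf x⟩
      · rintro ⟨y, hy, rfl⟩
        simpa [hfg y (hKU hy)] using hy
  · rintro ⟨hdet, hproper⟩
    have : LocallyCompactSpace U := hUopen.locallyCompactSpace
    have : LocallyPathConnectedSpace U := hUopen.locallyPathConnectedSpace
    have : ContractibleSpace U := hUconv.contractibleSpace ⟨f 0, hrange 0⟩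
    have hl : IsLocalHomeomorph (Set.codRestrict f U hrange) :=
      .of_comp (g := Subtype.val) (hf.isLocalHomeomorph_of_det_ne_zero hdet)
        hUopen.isOpenEmbedding_subtypeVal.isLocalHomeomorph (hf.continuous.codRestrict hrange)
    obtain ⟨hinj, hsurj⟩ :=
      (isProperMap_codRestrict hf.continuous hrange hproper).bijective_of_isLocalHomeomorph hl
    have hfinj : Function.Injective f := fun x y hxy ↦ hinj (Subtype.ext hxy)
    have hfsurj : ∀ y ∈ U, ∃ x, f x = y := fun y hy ↦ by
      obtain ⟨x, hx⟩ := hsurj ⟨y, hy⟩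
      exact ⟨x, congrArg Subtype.val hx⟩
    have hgf : Function.LeftInverse (Function.invFun f) f := Function.leftInverse_invFun hfinj
    refine ⟨⟨fun x _ ↦ hrange x, hfinj.injOn, fun y hy ↦ ?_⟩, Function.invFun f, hgf,
      fun y hy ↦ Function.invFun_eq (hfsurj y hy), fun y hy ↦ ?_⟩
    · simpa using hfsurj y hy
    · obtain ⟨x, rfl⟩ := hfsurj y hy
      exact (hf.contDiffAt_leftInverse_of_det_ne_zero hgf (hdet x)).contDiffWithinAt
end

section
/- Let U ⊆ ℝ^n be open and let f : ℝ^n → U be continuous. Then f is proper as a map into U if and only if the following holds: for every sequence (x_k) in ℝ^n with ‖x_k‖ = 1 for all k and x_k → x, every sequence (t_k) of positive reals with t_k → ∞, and every y ∈ ℝ^n, if f(t_k x_k) → y then y lies in the topological boundary ∂U of U. -/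
/-- a continuous map f : ℝ^n → U (U open) is proper as a map into U
iff limits of f along diverging sequences t_k x_k (with x_k on the unit sphere,
x_k → x, t_k → ∞) can only lie on the boundary of U. -/
theorem proper_iff_sequences (n : ℕ) (U : Set (EuclideanSpace ℝ (Fin n)))
    (hUopen : IsOpen U)
    (f : EuclideanSpace ℝ (Fin n) → EuclideanSpace ℝ (Fin n))
    (hf : Continuous f) (hrange : ∀ x, f x ∈ U) :
    (∀ K ⊆ U, IsCompact K → IsCompact (f ⁻¹' K)) ↔
    (∀ (x : EuclideanSpace ℝ (Fin n)) (xs : ℕ → EuclideanSpace ℝ (Fin n))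
        (ts : ℕ → ℝ) (y : EuclideanSpace ℝ (Fin n)),
      (∀ k, ‖xs k‖ = 1) → Filter.Tendsto xs Filter.atTop (nhds x) →
      (∀ k, 0 < ts k) → Filter.Tendsto ts Filter.atTop Filter.atTop →
      Filter.Tendsto (fun k => f (ts k • xs k)) Filter.atTop (nhds y) →
      y ∈ frontier U) := by
  constructor
  · intro hK x xs ts y hxs _ hts htop hlim
    rw [hUopen.frontier_eq]
    refine ⟨mem_closure_of_tendsto hlim (Filter.Eventually.of_forall fun k => hrange _),
      fun hyU => ?_⟩
    obtain ⟨K, hKc, hyK, hKU⟩ := exists_compact_subset hUopen hyU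
    obtain ⟨R, hR⟩ := (hK K hKU hKc).isBounded.exists_norm_le
    obtain ⟨k, hk, hkR⟩ := ((hlim.eventually (mem_interior_iff_mem_nhds.1 hyK)).and
      (htop.eventually_gt_atTop R)).exists
    have h := hR _ hk
    rw [norm_smul, hxs, mul_one, Real.norm_of_nonneg (hts k).le] at h
    exact absurd h (not_le.2 hkR)
  · intro H K hKU hK
    refine Metric.isCompact_of_isClosed_isBounded (hK.isClosed.preimage hf) ?_
    by_contra hunb
    have hex : ∀ k : ℕ, ∃ z, z ∈ f ⁻¹' K ∧ (k : ℝ) < ‖z‖ := by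
      intro k
      by_contra! hle
      exact hunb (isBounded_iff_forall_norm_le.2 ⟨k, hle⟩)
    choose z hzK hz using hex
    have hpos : ∀ k, 0 < ‖z k‖ := fun k => (Nat.cast_nonneg k).trans_lt (hz k)
    have hunit : ∀ k, ‖(‖z k‖⁻¹ • z k)‖ = 1 := fun k => by
      rw [norm_smul, norm_inv, norm_norm, inv_mul_cancel₀ (hpos k).ne']
    obtain ⟨p, hp, φ, hφ, hlim⟩ := ((isCompact_sphere (0 : EuclideanSpace ℝ (Fin n)) 1).prod
      hK).tendsto_subseq (x := fun k => (‖z k‖⁻¹ • z k, f (z k)))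
      fun k => ⟨mem_sphere_zero_iff_norm.2 (hunit k), hzK k⟩
    have hnorm : Filter.Tendsto (fun k => ‖z k‖) Filter.atTop Filter.atTop :=
      Filter.tendsto_atTop_mono (fun k => (hz k).le) tendsto_natCast_atTop_atTop
    have hmem : p.2 ∈ frontier U := by
      refine H p.1 (fun k => ‖z (φ k)‖⁻¹ • z (φ k)) (fun k => ‖z (φ k)‖) p.2
        (fun k => hunit _) hlim.fst_nhds (fun k => hpos _)
        (hnorm.comp hφ.tendsto_atTop) ?_
      simp only [smul_inv_smul₀ (hpos _).ne']
      exact hlim.snd_nhds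
    rw [hUopen.frontier_eq] at hmem
    exact hmem.2 (hKU hp.2)
end

section
/- For every ξ ∈ ℝ^{d_P}, the moment map p is differentiable at ξ, its derivative J_p(ξ) : ℝ^{d_P} → ℝ^m is injective, and the range of J_p(ξ) equals T = ker 𝒜. -/
/-- The average of the points `v k` with weights proportional to `exp (a k x)`. -/
noncomputable def gibbsMean {κ E F : Type*} [Fintype κ] [NormedAddCommGroup E] [NormedSpace ℝ E]
    [NormedAddCommGroup F] [NormedSpace ℝ F] (a : κ → E →L[ℝ] ℝ) (v : κ → F) (x : E) : F :=
  (∑ k, Real.exp (a k x))⁻¹ • ∑ k, Real.exp (a k x) • v k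

section gibbsMean

variable {κ E F : Type*} [Fintype κ] [NormedAddCommGroup E] [NormedSpace ℝ E]
  [NormedAddCommGroup F] [NormedSpace ℝ F] (a : κ → E →L[ℝ] ℝ) (v : κ → F) (x : E)

theorem map_gibbsMean {F' : Type*} [NormedAddCommGroup F'] [NormedSpace ℝ F'] (f : F →ₗ[ℝ] F') :
    f (gibbsMean a v x) = gibbsMean a (fun k => f (v k)) x := by
  simp [gibbsMean, map_sum]

variable [Nonempty κ]

theorem sum_exp_pos : 0 < ∑ k, Real.exp (a k x) :=
  Finset.sum_pos (fun _ _ => Real.exp_pos _) Finset.univ_nonempty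

theorem gibbsMean_const (c : F) : gibbsMean a (fun _ => c) x = c := by
  rw [gibbsMean, ← Finset.sum_smul, smul_smul, inv_mul_cancel₀ (sum_exp_pos a x).ne', one_smul]

theorem hasFDerivAt_gibbsMean :
    HasFDerivAt (gibbsMean a v) ((∑ k, Real.exp (a k x))⁻¹ •
      ∑ k, (Real.exp (a k x) • a k).smulRight (v k - gibbsMean a v x)) x := by
  have hw (k : κ) : HasFDerivAt (fun y => Real.exp (a k y)) (Real.exp (a k x) • a k) x :=
    (a k).hasFDerivAt.exp
  have hZ := HasFDerivAt.fun_sum (u := Finset.univ) fun k _ => hw k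
  have hN := HasFDerivAt.fun_sum (u := Finset.univ) fun k _ => (hw k).smul_const (v k)
  have hZ0 := (sum_exp_pos a x).ne'
  have hinv := (hasDerivAt_inv hZ0).comp_hasFDerivAt x hZ
  refine (hinv.smul hN).congr_fderiv ?_
  ext y
  simp only [gibbsMean, Function.comp_apply, add_apply, smul_apply, sum_apply,
    ContinuousLinearMap.smulRight_apply, smul_sub, Finset.sum_sub_distrib, smul_eq_mul,
    ← Finset.sum_smul]
  rw [sub_eq_add_neg]
  congr 1
  rw [smul_smul, smul_smul, ← neg_smul]
  congr 1
  field_simp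

theorem fderiv_gibbsMean_apply (y : E) :
    fderiv ℝ (gibbsMean a v) x y = (∑ k, Real.exp (a k x))⁻¹ •
      ∑ k, (Real.exp (a k x) * a k y) • (v k - gibbsMean a v x) := by
  simp [(hasFDerivAt_gibbsMean a v x).fderiv]

/-- The derivative is a covariance, so if it kills `y` then the variance of `k ↦ a k y` vanishes and
the values `a k y = f (v k)` all agree with their mean. -/
theorem eq_gibbsMean_of_fderiv_eq_zero {y : E} (f : F →ₗ[ℝ] ℝ) (hf : ∀ k, f (v k) = a k y)
    (h : fderiv ℝ (gibbsMean a v) x y = 0) (k : κ) : f (v k) = f (gibbsMean a v x) := by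
  set c := f (gibbsMean a v x) with hc
  have hZ0 := (sum_exp_pos a x).ne'
  have hcov : ∑ k, Real.exp (a k x) * f (v k) * (f (v k) - c) = 0 := by
    have := congrArg f h
    rw [fderiv_gibbsMean_apply, map_smul, map_zero, smul_eq_mul] at this
    simpa [map_sum, hf, ← hc, hZ0] using this
  have hmean : ∑ k, Real.exp (a k x) * (f (v k) - c) = 0 := by
    have : c = (∑ k, Real.exp (a k x))⁻¹ * ∑ k, Real.exp (a k x) * f (v k) := by
      rw [hc, map_gibbsMean, gibbsMean]; simp
    simp only [mul_sub, Finset.sum_sub_distrib, ← Finset.sum_mul]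
    rw [this]
    field_simp
    ring
  have hvar : ∑ k, Real.exp (a k x) * (f (v k) - c) ^ 2 = 0 := by
    calc _ = ∑ k, Real.exp (a k x) * f (v k) * (f (v k) - c)
          - c * ∑ k, Real.exp (a k x) * (f (v k) - c) := by
          rw [Finset.mul_sum, ← Finset.sum_sub_distrib]
          exact Finset.sum_congr rfl fun _ _ => by ring
      _ = 0 := by rw [hcov, hmean]; ring
  have := (Finset.sum_eq_zero_iff_of_nonneg fun k _ => by positivity).1 hvar k (Finset.mem_univ k)
  have := (mul_eq_zero.1 this).resolve_left (Real.exp_pos _).ne'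
  exact sub_eq_zero.1 (pow_eq_zero_iff two_ne_zero |>.1 this)

theorem fderiv_gibbsMean_mem (S : Submodule ℝ F) (hS : ∀ i j, v i - v j ∈ S) (y : E) :
    fderiv ℝ (gibbsMean a v) x y ∈ S := by
  rw [fderiv_gibbsMean_apply]
  refine S.smul_mem _ (S.sum_mem fun k _ => S.smul_mem _ ?_)
  have : v k - gibbsMean a v x =
      (∑ i, Real.exp (a i x))⁻¹ • ∑ i, Real.exp (a i x) • (v k - v i) := by
    conv_lhs => rw [← gibbsMean_const a x (v k)]
    simp [gibbsMean, smul_sub]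
  rw [this]
  exact S.smul_mem _ (S.sum_mem fun i _ => S.smul_mem _ (hS k i))

end gibbsMean

section coefficientPolytope

variable {ι κ : Type*} [Fintype ι] (A : Matrix κ ι ℝ)

theorem isCompact_coefficientPolytope :
    IsCompact {y : ι → ℝ | A.mulVec y = 0 ∧ (∀ j, 0 ≤ y j) ∧ ∑ j, y j = 1} := by
  refine (isCompact_stdSimplex ℝ ι).inter_left (s := {y | A.mulVec y = 0}) ?_
  exact isClosed_eq (Continuous.matrix_mulVec continuous_const continuous_id) continuous_const

theorem convex_coefficientPolytope :
    Convex ℝ {y : ι → ℝ | A.mulVec y = 0 ∧ (∀ j, 0 ≤ y j) ∧ ∑ j, y j = 1} :=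
  (LinearMap.ker A.mulVecLin).convex.inter (convex_stdSimplex ℝ ι)

/-- A direction of the polytope along which all extreme points have the same height vanishes. -/
theorem eq_zero_of_dotProduct_extremePoints_eq {y u : ι → ℝ} {c : ℝ}
    (hAy : A.mulVec y = 0) (hy : ∀ j, 0 < y j) (hy1 : ∑ j, y j = 1)
    (hAu : A.mulVec u = 0) (hu : ∑ j, u j = 0)
    (h : ∀ z ∈ Set.extremePoints ℝ
      {y : ι → ℝ | A.mulVec y = 0 ∧ (∀ j, 0 ≤ y j) ∧ ∑ j, y j = 1}, z ⬝ᵥ u = c) :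
    u = 0 := by
  have hall : ∀ z ∈ {y : ι → ℝ | A.mulVec y = 0 ∧ (∀ j, 0 ≤ y j) ∧ ∑ j, y j = 1},
      z ⬝ᵥ u = c := by
    rw [← closure_convexHull_extremePoints (isCompact_coefficientPolytope A)
      (convex_coefficientPolytope A)]
    refine closure_minimal (convexHull_min h ?_) ?_
    · exact convex_hyperplane (f := fun z => z ⬝ᵥ u)
        ⟨fun _ _ => add_dotProduct _ _ _, fun _ _ => smul_dotProduct _ _ _⟩ c
    · exact isClosed_eq (Continuous.dotProduct continuous_id continuous_const) continuous_const
  have hev : ∀ᶠ ε : ℝ in nhdsWithin 0 (Set.Ioi 0), ∀ j, 0 < y j + ε * u j := by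
    refine Filter.eventually_all.2 fun j => nhdsWithin_le_nhds ?_
    have : ContinuousAt (fun ε : ℝ => y j + ε * u j) 0 := by fun_prop
    exact this.eventually (lt_mem_nhds (by simpa using hy j))
  obtain ⟨ε, hε, hε0⟩ := (hev.and self_mem_nhdsWithin).exists
  have h1 := hall y ⟨hAy, fun j => (hy j).le, hy1⟩
  have h2 := hall (y + ε • u) ⟨by simp [Matrix.mulVec_add, Matrix.mulVec_smul, hAy, hAu],
    fun j => (hε j).le, by simp [Finset.sum_add_distrib, ← Finset.mul_sum, hy1, hu]⟩
  rw [add_dotProduct, smul_dotProduct, h1, smul_eq_mul, add_eq_left] at h2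
  exact dotProduct_self_eq_zero.1 ((mul_eq_zero.1 h2).resolve_left (ne_of_gt hε0))

end coefficientPolytope

/-- the moment map p is differentiable, with injective derivative whose range equals T. -/
theorem moment_map_derivative
    (l m n dP d nP : ℕ)
    (A : Matrix (Fin l) (Fin m) ℝ) (B : Matrix (Fin n) (Fin m) ℝ)
    (T D : Submodule ℝ (Fin m → ℝ))
    (hT : ∀ y : Fin m → ℝ, y ∈ T ↔ (A.mulVec y = 0 ∧ ∑ j, y j = 0))
    (hD : ∀ y : Fin m → ℝ, y ∈ D ↔ (B.mulVec y = 0 ∧ ∑ j, y j = 0))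
    (hdP : Module.finrank ℝ T = dP) (hd : Module.finrank ℝ D = d) (hdPd : dP = d)
    (G : Matrix (Fin m) (Fin dP) ℝ) (H : Matrix (Fin m) (Fin d) ℝ)
    (hGind : LinearIndependent ℝ (fun i : Fin dP => fun j => G j i))
    (hGrange : LinearMap.range G.mulVecLin = T)
    (hHind : LinearIndependent ℝ (fun i : Fin d => fun j => H j i))
    (hHrange : LinearMap.range H.mulVecLin = D)
    (P : Set (Fin m → ℝ))
    (hP : P = {y : Fin m → ℝ | A.mulVec y = 0 ∧ (∀ j, 0 < y j) ∧ ∑ j, y j = 1})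
    (hPne : P.Nonempty)
    (Pbar : Set (Fin m → ℝ))
    (hPbar : Pbar = {y : Fin m → ℝ | A.mulVec y = 0 ∧ (∀ j, 0 ≤ y j) ∧ ∑ j, y j = 1})
    (v : Fin nP → (Fin m → ℝ))
    (hv : Set.range v = Set.extremePoints ℝ Pbar)
    (p : (Fin dP → ℝ) → (Fin m → ℝ))
    (hp : ∀ ξ, p ξ = (∑ k, Real.exp (∑ j, v k j * G.mulVec ξ j))⁻¹ •
        ∑ k, Real.exp (∑ j, v k j * G.mulVec ξ j) • v k)
    :
    ∀ ξ : Fin dP → ℝ, DifferentiableAt ℝ p ξ ∧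
      Function.Injective (fderiv ℝ p ξ) ∧
      LinearMap.range (fderiv ℝ p ξ : (Fin dP → ℝ) →ₗ[ℝ] (Fin m → ℝ)) = T := by
  subst hP hPbar
  obtain ⟨y, hAy, hy, hy1⟩ := hPne
  have hvmem (k : Fin nP) := extremePoints_subset (hv ▸ Set.mem_range_self k)
  have : Nonempty (Fin nP) := by
    have hne := (isCompact_coefficientPolytope A).extremePoints_nonempty
      ⟨y, hAy, fun j => (hy j).le, hy1⟩
    exact Set.range_nonempty_iff_nonempty.1 (hv ▸ hne)
  let a (k : Fin nP) : (Fin dP → ℝ) →L[ℝ] ℝ :=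
    LinearMap.toContinuousLinearMap (dotProductBilin ℝ ℝ (v k) ∘ₗ G.mulVecLin)
  have hp' : p = gibbsMean a v := funext hp
  have hGinj : Function.Injective G.mulVec := Matrix.mulVec_injective_iff.2 hGind
  intro ξ
  have hinj : Function.Injective (fderiv ℝ p ξ) := by
    rw [injective_iff_map_eq_zero]
    intro η hη
    obtain ⟨hAu, hu⟩ := (hT _).1 (hGrange ▸ LinearMap.mem_range_self G.mulVecLin η)
    rw [hp'] at hη
    have hconst := eq_gibbsMean_of_fderiv_eq_zero a v ξ
      ((dotProductBilin ℝ ℝ).flip (G.mulVec η)) (fun _ => rfl) hη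
    have hu0 : G.mulVec η = 0 := by
      refine eq_zero_of_dotProduct_extremePoints_eq A hAy hy hy1 hAu hu ?_
        (c := gibbsMean a v ξ ⬝ᵥ G.mulVec η)
      rw [← hv]
      rintro _ ⟨k, rfl⟩
      exact hconst k
    exact hGinj (hu0.trans (Matrix.mulVec_zero G).symm)
  refine ⟨hp' ▸ (hasFDerivAt_gibbsMean a v ξ).differentiableAt, hinj, ?_⟩
  refine Submodule.eq_of_le_of_finrank_eq ?_ ?_
  · rintro _ ⟨η, rfl⟩
    rw [hp']
    refine fderiv_gibbsMean_mem a v ξ T (fun i j => (hT _).2 ⟨?_, ?_⟩) η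
    · rw [Matrix.mulVec_sub, (hvmem i).1, (hvmem j).1, sub_zero]
    · simp [(hvmem i).2.2, (hvmem j).2.2]
  · rw [LinearMap.finrank_range_of_inj hinj, hdP, Module.finrank_fin_fun]
end

section
/- The map f is differentiable, and the following are equivalent: (i) the derivative J_f(ξ) : ℝ^{d_P} → ℝ^d is injective for all ξ ∈ ℝ^{d_P}; (ii) for all ξ ∈ ℝ^{d_P}, the matrix Hᵀ · diag(p(ξ))^{-1} · G ∈ ℝ^{d×d_P} is injective, where diag(p(ξ))^{-1} is the diagonal matrix with entries 1/p(ξ)_j. -/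
/-- The derivative of an exponentially weighted mean of finitely many points. -/
theorem hasFDerivAt_exp_weighted_mean {ι E F : Type*} [Fintype ι]
    [NormedAddCommGroup E] [NormedSpace ℝ E] [NormedAddCommGroup F] [NormedSpace ℝ F]
    (c : ι → E →L[ℝ] ℝ) (v : ι → F) (ξ : E) (hS : ∑ k, Real.exp (c k ξ) ≠ 0) :
    ∃ L : E →L[ℝ] F,
      HasFDerivAt (fun ξ => (∑ k, Real.exp (c k ξ))⁻¹ • ∑ k, Real.exp (c k ξ) • v k) L ξ ∧
      ∀ η, L η = (∑ k, Real.exp (c k ξ))⁻¹ • ∑ k, (Real.exp (c k ξ) *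
        (c k η - (∑ l, Real.exp (c l ξ))⁻¹ * ∑ l, Real.exp (c l ξ) * c l η)) • v k := by
  have hE : ∀ k, HasFDerivAt (fun ξ => Real.exp (c k ξ)) (Real.exp (c k ξ) • c k) ξ :=
    fun k => (c k).hasFDerivAt.exp
  have hsum := HasFDerivAt.fun_sum (u := Finset.univ) fun k _ => hE k
  have hnum := HasFDerivAt.fun_sum (u := Finset.univ) fun k _ => (hE k).smul_const (v k)
  have hinv := (hasDerivAt_inv hS).comp_hasFDerivAt ξ hsum
  refine ⟨_, hinv.smul hnum, fun η => ?_⟩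
  simp only [add_apply, smul_apply,
    ContinuousLinearMap.smulRight_apply, sum_apply, Function.comp_apply,
    smul_eq_mul, mul_sub, sub_smul, Finset.sum_sub_distrib, smul_sub]
  rw [sub_eq_add_neg]
  congr 1
  simp only [← mul_smul, Finset.smul_sum, ← Finset.sum_neg_distrib, ← neg_smul]
  refine Finset.sum_congr rfl fun k _ => ?_
  congr 1
  field_simp

/-- A continuous linear functional that is constant on the extreme points of a compact convex set
is constant on the set. -/
theorem eq_of_forall_mem_extremePoints_eq {E : Type*} [NormedAddCommGroup E] [NormedSpace ℝ E]
    {s : Set E} (hs : IsCompact s) (hconv : Convex ℝ s) (φ : E →L[ℝ] ℝ) {a : ℝ}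
    (h : ∀ x ∈ s.extremePoints ℝ, φ x = a) {x : E} (hx : x ∈ s) : φ x = a := by
  rw [← closure_convexHull_extremePoints hs hconv] at hx
  exact closure_minimal
    (convexHull_min h (convex_hyperplane φ.toLinearMap.isLinear a))
    (isClosed_eq φ.continuous continuous_const) hx

/-- The section of the standard simplex by the kernel of a matrix is compact. -/
theorem isCompact_kernel_simplex {κ ι : Type*} [Fintype ι] (A : Matrix κ ι ℝ) :
    IsCompact {y : ι → ℝ | A.mulVec y = 0 ∧ (∀ j, 0 ≤ y j) ∧ ∑ j, y j = 1} := by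
  have hset : {y : ι → ℝ | A.mulVec y = 0 ∧ (∀ j, 0 ≤ y j) ∧ ∑ j, y j = 1} =
      stdSimplex ℝ ι ∩ {y | A.mulVec y = 0} := by
    ext y
    simp only [stdSimplex, Set.mem_inter_iff, Set.mem_ofPred_eq]
    tauto
  rw [hset]
  exact (isCompact_stdSimplex ℝ ι).inter_right
    (isClosed_eq (Continuous.matrix_mulVec continuous_const continuous_id) continuous_const)

/-- The section of the standard simplex by the kernel of a matrix is convex. -/
theorem convex_kernel_simplex {κ ι : Type*} [Fintype ι] (A : Matrix κ ι ℝ) :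
    Convex ℝ {y : ι → ℝ | A.mulVec y = 0 ∧ (∀ j, 0 ≤ y j) ∧ ∑ j, y j = 1} := by
  rintro x ⟨hx, hx0, hx1⟩ y ⟨hy, hy0, hy1⟩ a b ha hb hab
  refine ⟨by simp [Matrix.mulVec_add, Matrix.mulVec_smul, hx, hy], fun j => ?_, ?_⟩
  · have := mul_nonneg ha (hx0 j)
    have := mul_nonneg hb (hy0 j)
    simpa using by linarith
  · simp [Finset.sum_add_distrib, ← Finset.mul_sum, hx1, hy1, hab]

/-- If a direction tangent to a simplex section with a strictly positive point has constant inner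
product with all its extreme points, then the direction is zero. -/
theorem eq_zero_of_dotProduct_extremePoints_eq_s6 {κ ι : Type*} [Fintype ι]
    (A : Matrix κ ι ℝ) {y u : ι → ℝ} (hy : A.mulVec y = 0) (hy0 : ∀ j, 0 < y j)
    (hy1 : ∑ j, y j = 1) (hu : A.mulVec u = 0) (hu0 : ∑ j, u j = 0) {a : ℝ}
    (h : ∀ x ∈ Set.extremePoints ℝ
      {y : ι → ℝ | A.mulVec y = 0 ∧ (∀ j, 0 ≤ y j) ∧ ∑ j, y j = 1}, ∑ j, x j * u j = a) :
    u = 0 := by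
  let φ : (ι → ℝ) →L[ℝ] ℝ := ∑ j, u j • ContinuousLinearMap.proj j
  have hφ : ∀ x, φ x = ∑ j, x j * u j := fun x => by
    simp [φ, mul_comm]
  have hconst : ∀ x ∈ {y : ι → ℝ | A.mulVec y = 0 ∧ (∀ j, 0 ≤ y j) ∧ ∑ j, y j = 1}, φ x = a :=
    fun x hx => eq_of_forall_mem_extremePoints_eq (isCompact_kernel_simplex A)
      (convex_kernel_simplex A) φ (fun x hx => (hφ x).trans (h x hx)) hx
  have hev : ∀ᶠ t : ℝ in nhdsWithin 0 (Set.Ioi 0), ∀ j, 0 < y j + t * u j := by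
    refine Filter.Eventually.filter_mono nhdsWithin_le_nhds (Filter.eventually_all.2 fun j => ?_)
    have hc : Continuous fun t : ℝ => y j + t * u j := by fun_prop
    exact continuous_const.continuousAt.eventually_lt hc.continuousAt (by simpa using hy0 j)
  obtain ⟨t, ht, ht0⟩ := (hev.and self_mem_nhdsWithin).exists
  have h1 := hconst y ⟨hy, fun j => (hy0 j).le, hy1⟩
  have h2 := hconst (y + t • u) ⟨by simp [Matrix.mulVec_add, Matrix.mulVec_smul, hy, hu],
    fun j => by simpa using (ht j).le, by simp [Finset.sum_add_distrib, ← Finset.mul_sum, hy1, hu0]⟩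
  rw [map_add, map_smul, h1, hφ u, smul_eq_mul, add_eq_left] at h2
  have h3 : ∑ j, u j * u j = 0 := (mul_eq_zero.1 h2).resolve_left (ne_of_gt ht0)
  rw [Finset.sum_eq_zero_iff_of_nonneg fun j _ => mul_self_nonneg _] at h3
  exact funext fun j => mul_self_eq_zero.1 (h3 j (Finset.mem_univ j))

/-- Each coordinate that is positive somewhere on a simplex section is positive at some extreme
point. -/
theorem exists_extremePoint_pos {κ ι : Type*} [Fintype ι]
    (A : Matrix κ ι ℝ) {y : ι → ℝ} (hy : A.mulVec y = 0) (hy0 : ∀ j, 0 < y j)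
    (hy1 : ∑ j, y j = 1) (j : ι) :
    ∃ x ∈ Set.extremePoints ℝ
      {y : ι → ℝ | A.mulVec y = 0 ∧ (∀ j, 0 ≤ y j) ∧ ∑ j, y j = 1}, 0 < x j := by
  by_contra! hcon
  refine (hy0 j).ne' (eq_of_forall_mem_extremePoints_eq (isCompact_kernel_simplex A)
    (convex_kernel_simplex A) (ContinuousLinearMap.proj j) (a := 0)
    (fun x hx => le_antisymm (hcon x hx) ((extremePoints_subset hx).2.1 j))
    ⟨hy, fun j => (hy0 j).le, hy1⟩)

/-- If a weighted sum of deviations from the weighted mean, paired with the values, vanishes, then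
all values equal the mean. -/
theorem eq_mean_of_weighted_variance_eq_zero {ι : Type*} [Fintype ι] {w c : ι → ℝ} {μ : ℝ}
    (hw : ∀ k, 0 < w k) (hμ : ∑ k, w k * (c k - μ) = 0)
    (h : ∑ k, w k * (c k - μ) * c k = 0) (k : ι) : c k = μ := by
  have hsq : ∑ k, w k * (c k - μ) ^ 2 = 0 := by
    calc ∑ k, w k * (c k - μ) ^ 2
        = ∑ k, w k * (c k - μ) * c k - μ * ∑ k, w k * (c k - μ) := by
          rw [Finset.mul_sum, ← Finset.sum_sub_distrib]
          exact Finset.sum_congr rfl fun k _ => by ring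
      _ = 0 := by rw [h, hμ]; simp
  rw [Finset.sum_eq_zero_iff_of_nonneg fun k _ => mul_nonneg (hw k).le (sq_nonneg _)] at hsq
  have := (mul_eq_zero.1 (hsq k (Finset.mem_univ k))).resolve_left (hw k).ne'
  exact sub_eq_zero.1 (pow_eq_zero_iff two_ne_zero |>.1 this)

/-- The derivative of a product of real powers of positive functions. -/
theorem HasFDerivAt.prod_rpow_const {ι E : Type*} [Fintype ι] [NormedAddCommGroup E]
    [NormedSpace ℝ E] {q : E → ι → ℝ} {L : E →L[ℝ] ι → ℝ} {ξ : E}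
    (hq : HasFDerivAt q L ξ) (hpos : ∀ ξ j, 0 < q ξ j) (r : ι → ℝ) :
    HasFDerivAt (fun ξ => ∏ j, Real.rpow (q ξ j) (r j))
      ((∏ j, Real.rpow (q ξ j) (r j)) •
        ∑ j, (r j * (q ξ j)⁻¹) • (ContinuousLinearMap.proj j ∘L L)) ξ := by
  have heq : ∀ ξ, ∏ j, Real.rpow (q ξ j) (r j) = Real.exp (∑ j, r j * Real.log (q ξ j)) := by
    intro ξ
    rw [Real.exp_sum]
    refine Finset.prod_congr rfl fun j _ => ?_
    rw [mul_comm]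
    exact Real.rpow_def_of_pos (hpos ξ j) _
  simp only [heq]
  have hj : ∀ j, HasFDerivAt (fun ξ => r j * Real.log (q ξ j))
      ((r j * (q ξ j)⁻¹) • (ContinuousLinearMap.proj j ∘L L)) ξ := fun j => by
    rw [mul_smul]
    exact (((hasFDerivAt_pi'.1 hq) j).log (hpos ξ j).ne').const_mul (r j)
  exact (HasFDerivAt.fun_sum (u := Finset.univ) fun j _ => hj j).exp


/-- f is differentiable, and its derivative is everywhere injective iff the matrix Hᵀ diag(p(ξ))⁻¹ G is injective for all ξ. -/
theorem local_invertibility_first_characterization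
    (l m n dP d nP : ℕ)
    (A : Matrix (Fin l) (Fin m) ℝ) (B : Matrix (Fin n) (Fin m) ℝ)
    (T D : Submodule ℝ (Fin m → ℝ))
    (hT : ∀ y : Fin m → ℝ, y ∈ T ↔ (A.mulVec y = 0 ∧ ∑ j, y j = 0))
    (hD : ∀ y : Fin m → ℝ, y ∈ D ↔ (B.mulVec y = 0 ∧ ∑ j, y j = 0))
    (hdP : Module.finrank ℝ T = dP) (hd : Module.finrank ℝ D = d) (hdPd : dP = d)
    (G : Matrix (Fin m) (Fin dP) ℝ) (H : Matrix (Fin m) (Fin d) ℝ)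
    (hGind : LinearIndependent ℝ (fun i : Fin dP => fun j => G j i))
    (hGrange : LinearMap.range G.mulVecLin = T)
    (hHind : LinearIndependent ℝ (fun i : Fin d => fun j => H j i))
    (hHrange : LinearMap.range H.mulVecLin = D)
    (P : Set (Fin m → ℝ))
    (hP : P = {y : Fin m → ℝ | A.mulVec y = 0 ∧ (∀ j, 0 < y j) ∧ ∑ j, y j = 1})
    (hPne : P.Nonempty)
    (Pbar : Set (Fin m → ℝ))
    (hPbar : Pbar = {y : Fin m → ℝ | A.mulVec y = 0 ∧ (∀ j, 0 ≤ y j) ∧ ∑ j, y j = 1})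
    (v : Fin nP → (Fin m → ℝ))
    (hv : Set.range v = Set.extremePoints ℝ Pbar)
    (p : (Fin dP → ℝ) → (Fin m → ℝ))
    (hp : ∀ ξ, p ξ = (∑ k, Real.exp (∑ j, v k j * G.mulVec ξ j))⁻¹ •
        ∑ k, Real.exp (∑ j, v k j * G.mulVec ξ j) • v k)
    (f : (Fin dP → ℝ) → (Fin d → ℝ))
    (hf : ∀ ξ, f ξ = fun i => ∏ j, Real.rpow (p ξ j) (H j i))
    :
    Differentiable ℝ f ∧
    ((∀ ξ : Fin dP → ℝ, Function.Injective (fderiv ℝ f ξ)) ↔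
      (∀ ξ : Fin dP → ℝ,
        Function.Injective
          ((H.transpose * Matrix.diagonal (fun j => (p ξ j)⁻¹) * G).mulVecLin))) := by
  subst hP hPbar
  obtain ⟨y, hy, hy0, hy1⟩ := hPne
  have hvmem : ∀ k, v k ∈ Set.extremePoints ℝ
      {y : Fin m → ℝ | A.mulVec y = 0 ∧ (∀ j, 0 ≤ y j) ∧ ∑ j, y j = 1} :=
    fun k => hv ▸ Set.mem_range_self k
  have hvA : ∀ k, A.mulVec (v k) = 0 := fun k => (extremePoints_subset (hvmem k)).1
  have hv0 : ∀ k j, 0 ≤ v k j := fun k => (extremePoints_subset (hvmem k)).2.1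
  have hv1 : ∀ k, ∑ j, v k j = 1 := fun k => (extremePoints_subset (hvmem k)).2.2
  have hnum : ∀ (w : Fin nP → ℝ), (∀ k, 0 < w k) → ∀ j, 0 < ∑ k, w k * v k j := by
    intro w hw j
    obtain ⟨x, hx, hxj⟩ := exists_extremePoint_pos A hy hy0 hy1 j
    obtain ⟨k, rfl⟩ := hv ▸ hx
    exact Finset.sum_pos' (fun k _ => mul_nonneg (hw k).le (hv0 k j))
      ⟨k, Finset.mem_univ k, mul_pos (hw k) hxj⟩
  have hnonempty : Nonempty (Fin nP) := by
    have hm : Nonempty (Fin m) := by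
      by_contra hm
      rw [not_nonempty_iff] at hm
      simp at hy1
    obtain ⟨x, hx, -⟩ := exists_extremePoint_pos A hy hy0 hy1 hm.some
    obtain ⟨k, -⟩ := hv ▸ hx
    exact ⟨k⟩
  let c : Fin nP → (Fin dP → ℝ) →L[ℝ] ℝ := fun k =>
    LinearMap.toContinuousLinearMap ((Fintype.linearCombination ℝ (v k)) ∘ₗ G.mulVecLin)
  have hc : ∀ k ξ, c k ξ = ∑ j, v k j * G.mulVec ξ j := fun k ξ => by
    simp [c, Fintype.linearCombination_apply, mul_comm]
  simp only [← hc] at hp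
  have hSpos : ∀ ξ, 0 < ∑ k, Real.exp (c k ξ) := fun ξ =>
    Finset.sum_pos (fun k _ => Real.exp_pos _) Finset.univ_nonempty
  have hppos : ∀ ξ j, 0 < p ξ j := fun ξ j => by
    rw [hp]
    simpa using mul_pos (inv_pos.2 (hSpos ξ)) (hnum _ (fun k => Real.exp_pos (c k ξ)) j)
  have hGinj : Function.Injective G.mulVecLin := Matrix.mulVec_injective_iff.2 hGind
  have hGT : ∀ u, (∃ ζ, G.mulVec ζ = u) ↔ A.mulVec u = 0 ∧ ∑ j, u j = 0 := fun u => by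
    rw [← hT, ← hGrange]
    rfl
  obtain ⟨g, hg⟩ := LinearMap.exists_leftInverse_of_injective _ (LinearMap.ker_eq_bot.2 hGinj)
  have hpderiv : ∀ ξ, ∃ L : (Fin dP → ℝ) →L[ℝ] (Fin m → ℝ), HasFDerivAt p L ξ ∧
      Function.Injective L ∧ ∀ η, ∃ ζ, G.mulVec ζ = L η := by
    intro ξ
    obtain ⟨L, hL, hLη⟩ := hasFDerivAt_exp_weighted_mean c v ξ (hSpos ξ).ne'
    have hμ : ∀ η, ∑ k, Real.exp (c k ξ) *
        (c k η - (∑ l, Real.exp (c l ξ))⁻¹ * ∑ l, Real.exp (c l ξ) * c l η) = 0 := fun η => by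
      simp only [mul_sub, Finset.sum_sub_distrib, ← Finset.sum_mul]
      rw [mul_inv_cancel_left₀ (hSpos ξ).ne', sub_self]
    refine ⟨L, (funext hp : p = _) ▸ hL, ?_, fun η => ?_⟩
    · rw [injective_iff_map_eq_zero]
      intro η h0
      rw [hLη, smul_eq_zero, or_iff_right (inv_ne_zero (hSpos ξ).ne')] at h0
      have hvar := congrArg (fun x : Fin m → ℝ => ∑ j, x j * G.mulVec η j) h0
      simp only [Finset.sum_apply, Pi.smul_apply, smul_eq_mul, Pi.zero_apply, zero_mul,
        Finset.sum_const_zero, Finset.sum_mul] at hvar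
      rw [Finset.sum_comm] at hvar
      simp only [mul_assoc, ← Finset.mul_sum, ← hc] at hvar
      simp only [← mul_assoc] at hvar
      have hconst := eq_mean_of_weighted_variance_eq_zero (fun k => Real.exp_pos (c k ξ)) (hμ η) hvar
      obtain ⟨hu, hu0⟩ := (hGT (G.mulVec η)).1 ⟨η, rfl⟩
      have hz : G.mulVec η = 0 := by
        refine eq_zero_of_dotProduct_extremePoints_eq_s6 A hy hy0 hy1 hu hu0
          (a := (∑ l, Real.exp (c l ξ))⁻¹ * ∑ l, Real.exp (c l ξ) * c l η) fun x hx => ?_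
        obtain ⟨k, rfl⟩ := hv ▸ hx
        rw [← hc]
        exact hconst k
      exact hGinj (by simpa using hz)
    · rw [hGT, hLη]
      refine ⟨by simp [Matrix.mulVec_smul, Matrix.mulVec_sum, hvA], ?_⟩
      simp only [Pi.smul_apply, Finset.sum_apply, smul_eq_mul, ← Finset.mul_sum]
      rw [Finset.sum_comm]
      simp only [← Finset.mul_sum, hv1, mul_one]
      rw [hμ, mul_zero]
  choose L hL hLinj hLG using hpderiv
  have hfderiv : ∀ ξ, HasFDerivAt f (ContinuousLinearMap.pi fun i =>
      (∏ j, Real.rpow (p ξ j) (H j i)) •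
        ∑ j, (H j i * (p ξ j)⁻¹) • (ContinuousLinearMap.proj j ∘L L ξ)) ξ := fun ξ => by
    rw [(funext hf : f = _)]
    exact hasFDerivAt_pi.2 fun i => (hL ξ).prod_rpow_const hppos fun j => H j i
  have hker : ∀ ξ η ζ, G.mulVec ζ = L ξ η →
      (fderiv ℝ f ξ η = 0 ↔
        (H.transpose * Matrix.diagonal (fun j => (p ξ j)⁻¹) * G).mulVecLin ζ = 0) := by
    intro ξ η ζ h
    rw [(hfderiv ξ).fderiv, Matrix.mulVecLin_apply, ← Matrix.mulVec_mulVec, h,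
      funext_iff, funext_iff]
    refine forall_congr' fun i => ?_
    have hne : ∏ j, Real.rpow (p ξ j) (H j i) ≠ 0 :=
      (Finset.prod_pos fun j _ => Real.rpow_pos_of_pos (hppos ξ j) _).ne'
    simp only [ContinuousLinearMap.pi_apply, smul_apply, Pi.zero_apply,
      smul_eq_mul, mul_eq_zero, hne, false_or]
    simp [Matrix.mulVec, dotProduct, Matrix.mul_diagonal]
  refine ⟨fun ξ => (hfderiv ξ).differentiableAt, forall_congr' fun ξ => ?_⟩
  rw [injective_iff_map_eq_zero, injective_iff_map_eq_zero]
  constructor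
  · intro h ζ hζ
    have hGg : ∀ η, G.mulVec (g (L ξ η)) = L ξ η := fun η => by
      obtain ⟨ζ, h⟩ := hLG ξ η
      rw [← h]
      exact congrArg G.mulVec (LinearMap.congr_fun hg ζ)
    have hMinj : Function.Injective (g ∘ₗ (L ξ).toLinearMap) := fun η₁ η₂ h => by
      apply hLinj ξ
      rw [← hGg, ← hGg η₂]
      exact congrArg G.mulVec h
    obtain ⟨η, rfl⟩ := LinearMap.injective_iff_surjective.1 hMinj ζ
    rw [h η ((hker ξ η _ (hGg η)).2 hζ), map_zero]
  · intro h η hη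
    obtain ⟨ζ, hζ⟩ := hLG ξ η
    have hζ0 := h ζ ((hker ξ η ζ hζ).1 hη)
    rw [hζ0, Matrix.mulVec_zero] at hζ
    exact hLinj ξ (by rw [← hζ, map_zero])
end

section
/- The map f is proper as a map into the positive orthant {z ∈ ℝ^d : z > 0} if and only if the following ray condition holds for every nonzero ξ ∈ ℝ^{d_P}: for every z ∈ ℝ^d, if f(tξ) → z as t → ∞, then z lies in the boundary of the nonnegative orthant, i.e., z ≥ 0 and z_i = 0 for some i. -/
open Filter Topology in
/-- `φ` is the continuous, positively homogeneous leading part of `g` at infinity: `g` stays within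
bounded distance of `φ`, and `g - φ` converges along every ray. -/
structure HasRecession {E : Type*} [NormedAddCommGroup E] [NormedSpace ℝ E]
    (g φ : E → ℝ) : Prop where
  continuous : Continuous φ
  map_smul : ∀ t : ℝ, 0 ≤ t → ∀ x, φ (t • x) = t * φ x
  bounded : ∃ C, ∀ x, |g x - φ x| ≤ C
  tendsto : ∀ x, ∃ L, Tendsto (fun t : ℝ => g (t • x) - t * φ x) atTop (𝓝 L)

namespace HasRecession

open Filter Topology

variable {E F : Type*} [NormedAddCommGroup E] [NormedSpace ℝ E]
  [NormedAddCommGroup F] [NormedSpace ℝ F]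

theorem zero : HasRecession (fun _ : E => 0) (fun _ => 0) where
  continuous := continuous_const
  map_smul := by simp
  bounded := ⟨0, by simp⟩
  tendsto := fun x => ⟨0, by simp⟩

theorem add {g₁ g₂ φ₁ φ₂ : E → ℝ} (h₁ : HasRecession g₁ φ₁) (h₂ : HasRecession g₂ φ₂) :
    HasRecession (fun x => g₁ x + g₂ x) (fun x => φ₁ x + φ₂ x) where
  continuous := h₁.continuous.add h₂.continuous
  map_smul t ht x := by rw [h₁.map_smul t ht, h₂.map_smul t ht]; ring
  bounded := by
    obtain ⟨C₁, hC₁⟩ := h₁.bounded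
    obtain ⟨C₂, hC₂⟩ := h₂.bounded
    refine ⟨C₁ + C₂, fun x => ?_⟩
    rw [add_sub_add_comm]
    exact (abs_add_le _ _).trans (add_le_add (hC₁ x) (hC₂ x))
  tendsto x := by
    obtain ⟨L₁, hL₁⟩ := h₁.tendsto x
    obtain ⟨L₂, hL₂⟩ := h₂.tendsto x
    exact ⟨L₁ + L₂, (hL₁.add hL₂).congr fun t => by ring⟩

theorem const_mul {g φ : E → ℝ} (h : HasRecession g φ) (a : ℝ) :
    HasRecession (fun x => a * g x) (fun x => a * φ x) where
  continuous := h.continuous.const_mul a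
  map_smul t ht x := by rw [h.map_smul t ht]; ring
  bounded := by
    obtain ⟨C, hC⟩ := h.bounded
    refine ⟨|a| * C, fun x => ?_⟩
    rw [← mul_sub, abs_mul]
    exact mul_le_mul_of_nonneg_left (hC x) (abs_nonneg a)
  tendsto x := by
    obtain ⟨L, hL⟩ := h.tendsto x
    exact ⟨a * L, (hL.const_mul a).congr fun t => by ring⟩

theorem sub {g₁ g₂ φ₁ φ₂ : E → ℝ} (h₁ : HasRecession g₁ φ₁) (h₂ : HasRecession g₂ φ₂) :
    HasRecession (fun x => g₁ x - g₂ x) (fun x => φ₁ x - φ₂ x) := by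
  simpa [sub_eq_add_neg] using h₁.add (h₂.const_mul (-1))

theorem sum {ι : Type*} (s : Finset ι) {g φ : ι → E → ℝ}
    (h : ∀ i, HasRecession (g i) (φ i)) :
    HasRecession (fun x => ∑ i ∈ s, g i x) (fun x => ∑ i ∈ s, φ i x) := by
  classical
  induction s using Finset.induction_on with
  | empty => simpa using zero
  | insert a s ha ih => simpa [Finset.sum_insert ha] using (h a).add ih

theorem comp {g φ : F → ℝ} (h : HasRecession g φ) (A : E →L[ℝ] F) :
    HasRecession (fun x => g (A x)) (fun x => φ (A x)) where
  continuous := h.continuous.comp A.continuous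
  map_smul t ht x := by rw [_root_.map_smul, h.map_smul t ht]
  bounded := h.bounded.imp fun _ hC x => hC (A x)
  tendsto x := by simpa using h.tendsto (A x)

/-- The leading part of a weighted log-sum-exp is the maximum of the exponents carrying a
positive weight. -/
theorem exists_log_sum_exp {ι : Type*} [Fintype ι] (c : ι → ℝ) (hc : ∀ k, 0 ≤ c k)
    (hpos : ∃ k, 0 < c k) :
    ∃ M : (ι → ℝ) → ℝ, HasRecession (fun w => Real.log (∑ k, c k * Real.exp (w k))) M := by
  classical
  set S : Finset ι := Finset.univ.filter fun k => 0 < c k with hS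
  have hSne : S.Nonempty := hpos.imp fun k hk => by simp [hS, hk]
  have hc0 : ∀ k, k ∉ S → c k = 0 := fun k hk =>
    le_antisymm (by simpa [hS] using hk) (hc k)
  have hsum : 0 < ∑ k, c k := by
    obtain ⟨k, hk⟩ := hpos
    exact Finset.sum_pos' (fun k _ => hc k) ⟨k, Finset.mem_univ k, hk⟩
  have hsumexp : ∀ w : ι → ℝ, 0 < ∑ k, c k * Real.exp (w k) := fun w => by
    obtain ⟨k, hk⟩ := hpos
    exact Finset.sum_pos' (fun k _ => mul_nonneg (hc k) (Real.exp_pos _).le)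
      ⟨k, Finset.mem_univ k, mul_pos hk (Real.exp_pos _)⟩
  refine ⟨fun w => S.sup' hSne w, ?_, ?_, ?_, ?_⟩
  · exact Continuous.finset_sup'_apply hSne fun k _ => continuous_apply k
  · intro t ht w
    exact (Finset.apply_sup'_eq_sup'_comp hSne (fun x : ℝ => t * x)
      (fun x y => mul_max_of_nonneg x y ht)).symm
  · refine ⟨|Real.log (∑ k, c k)| + ∑ k ∈ S, |Real.log (c k)|, fun w => ?_⟩
    have hnn : 0 ≤ ∑ k ∈ S, |Real.log (c k)| := Finset.sum_nonneg fun _ _ => abs_nonneg _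
    obtain ⟨k₀, hk₀, hM⟩ := S.exists_mem_eq_sup' hSne w
    have hck₀ : 0 < c k₀ := by simpa [hS] using hk₀
    have hupper : ∑ k, c k * Real.exp (w k) ≤ (∑ k, c k) * Real.exp (S.sup' hSne w) := by
      rw [Finset.sum_mul]
      refine Finset.sum_le_sum fun k _ => ?_
      by_cases hk : k ∈ S
      · exact mul_le_mul_of_nonneg_left (Real.exp_le_exp.2 (S.le_sup' w hk)) (hc k)
      · simp [hc0 k hk]
    have hlower : c k₀ * Real.exp (S.sup' hSne w) ≤ ∑ k, c k * Real.exp (w k) := by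
      rw [hM]
      exact Finset.single_le_sum (f := fun k => c k * Real.exp (w k))
        (fun k _ => mul_nonneg (hc k) (Real.exp_pos _).le) (Finset.mem_univ k₀)
    have h₁ := Real.log_le_log (hsumexp w) hupper
    have h₂ := Real.log_le_log (mul_pos hck₀ (Real.exp_pos _)) hlower
    rw [Real.log_mul hsum.ne' (Real.exp_pos _).ne', Real.log_exp] at h₁
    rw [Real.log_mul hck₀.ne' (Real.exp_pos _).ne', Real.log_exp] at h₂
    have h₃ : |Real.log (c k₀)| ≤ ∑ k ∈ S, |Real.log (c k)| :=
      Finset.single_le_sum (f := fun k => |Real.log (c k)|) (fun _ _ => abs_nonneg _) hk₀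
    rw [abs_le]
    constructor
    · linarith [neg_abs_le (Real.log (c k₀)), abs_nonneg (Real.log (∑ k, c k))]
    · linarith [le_abs_self (Real.log (∑ k, c k))]
  · intro w
    set M := S.sup' hSne w with hMdef
    obtain ⟨k₀, hk₀, hM⟩ := S.exists_mem_eq_sup' hSne w
    have hck₀ : 0 < c k₀ := by simpa [hS] using hk₀
    have hlim : Tendsto (fun t : ℝ => ∑ k, c k * Real.exp (t * (w k - M))) atTop
        (𝓝 (∑ k, if w k = M then c k else 0)) := by
      refine tendsto_finsetSum _ fun k _ => ?_
      by_cases hk : k ∈ S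
      · split_ifs with hwk
        · simp [hwk]
        · have hlt : w k - M < 0 := sub_neg.2 (lt_of_le_of_ne (S.le_sup' w hk) hwk)
          simpa using (Real.tendsto_exp_atBot.comp
            (tendsto_id.atTop_mul_const_of_neg hlt)).const_mul (c k)
      · simp [hc0 k hk]
    have hlimpos : 0 < ∑ k, if w k = M then c k else 0 := by
      refine Finset.sum_pos' (fun k _ => ?_) ⟨k₀, Finset.mem_univ k₀, ?_⟩
      · split_ifs <;> simp [hc k]
      · rw [if_pos (hMdef.trans hM).symm]; exact hck₀
    refine ⟨_, (hlim.log hlimpos.ne').congr fun t => ?_⟩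
    have hfac : ∑ k, c k * Real.exp ((t • w) k) =
        (∑ k, c k * Real.exp (t * (w k - M))) * Real.exp (t * M) := by
      rw [Finset.sum_mul]
      refine Finset.sum_congr rfl fun k _ => ?_
      rw [mul_assoc, ← Real.exp_add, Pi.smul_apply, smul_eq_mul]
      congr 2
      ring
    have hne : ∑ k, c k * Real.exp (t * (w k - M)) ≠ 0 :=
      (hsumexp fun k => t * (w k - M)).ne'
    rw [hfac, Real.log_mul hne (Real.exp_pos _).ne', Real.log_exp]
    ring

/-- A map into the positive orthant whose logarithm has a leading part at infinity is proper iff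
no ray is sent to a curve converging inside the positive orthant. -/
theorem proper_iff [ProperSpace E] {ι : Type*} [Fintype ι] {g φ : ι → E → ℝ} {f : E → ι → ℝ}
    (h : ∀ i, HasRecession (g i) (φ i)) (hg : ∀ i, Continuous (g i))
    (hf : ∀ x i, f x i = Real.exp (g i x)) :
    (∀ K ⊆ {z : ι → ℝ | ∀ i, 0 < z i}, IsCompact K → IsCompact (f ⁻¹' K)) ↔
    (∀ x : E, x ≠ 0 → ∀ z : ι → ℝ, Tendsto (fun t : ℝ => f (t • x)) atTop (𝓝 z) →
      ((∀ i, 0 ≤ z i) ∧ ∃ i, z i = 0)) := by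
  constructor
  · intro hproper x hx z hz
    have hz0 : ∀ i, 0 ≤ z i := fun i =>
      ge_of_tendsto' ((tendsto_pi_nhds.1 hz) i) fun t => by rw [hf]; exact (Real.exp_pos _).le
    refine ⟨hz0, ?_⟩
    by_contra! hne
    have hzpos : ∀ i, 0 < z i := fun i => lt_of_le_of_ne (hz0 i) (hne i).symm
    have hopen : IsOpen {z : ι → ℝ | ∀ i, 0 < z i} := by
      simp only [Set.ofPred_forall]
      exact isOpen_iInter_of_finite fun i => isOpen_lt continuous_const (continuous_apply i)
    obtain ⟨K, hK, hzK, hKpos⟩ := exists_compact_subset hopen hzpos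
    obtain ⟨R, hR⟩ := (hproper K hKpos hK).isBounded.exists_norm_le
    have hev : ∀ᶠ t : ℝ in atTop, ‖t • x‖ ≤ R :=
      (hz.eventually (mem_interior_iff_mem_nhds.1 hzK)).mono fun t ht => hR _ ht
    have hinf : Tendsto (fun t : ℝ => t * ‖x‖) atTop atTop :=
      tendsto_id.atTop_mul_const (norm_pos_iff.2 hx)
    obtain ⟨t, ht, htR⟩ := (hev.and (hinf.eventually_gt_atTop R)).exists
    rw [norm_smul] at ht
    have := mul_le_mul_of_nonneg_right (le_abs_self t) (norm_nonneg x)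
    rw [Real.norm_eq_abs] at ht
    linarith
  · intro hray K hKpos hK
    set Φ : E → ι → ℝ := fun x i => φ i x with hΦ
    have hΦcont : Continuous Φ := continuous_pi fun i => (h i).continuous
    have hΦsmul : ∀ t : ℝ, 0 ≤ t → ∀ x, Φ (t • x) = t • Φ x := fun t ht x =>
      funext fun i => (h i).map_smul t ht x
    have hΦne : ∀ x, x ≠ 0 → Φ x ≠ 0 := by
      intro x hx h0
      choose L hL using fun i => (h i).tendsto x
      obtain ⟨-, i, hi⟩ := hray x hx (fun i => Real.exp (L i)) <| tendsto_pi_nhds.2 fun i => by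
        have h0i : φ i x = 0 := congrFun h0 i
        simpa [hf, h0i] using (hL i).rexp
      exact (Real.exp_pos _).ne' hi
    obtain ⟨c, hc, hclow⟩ : ∃ c > 0, ∀ x, c * ‖x‖ ≤ ‖Φ x‖ := by
      obtain ⟨c, hc, hcS⟩ : ∃ c > 0, ∀ x ∈ Metric.sphere (0 : E) 1, c ≤ ‖Φ x‖ := by
        refine (isCompact_sphere (0 : E) 1).exists_forall_le' hΦcont.norm.continuousOn fun x hx => ?_
        exact norm_pos_iff.2 (hΦne x (ne_zero_of_mem_unit_sphere ⟨x, hx⟩))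
      refine ⟨c, hc, fun x => ?_⟩
      rcases eq_or_ne x 0 with rfl | hx
      · simp
      have hx' := norm_pos_iff.2 hx
      have h1 := hcS (‖x‖⁻¹ • x) (by simp [norm_smul, hx'.ne'])
      rw [hΦsmul _ (inv_nonneg.2 hx'.le), norm_smul, norm_inv, norm_norm] at h1
      rwa [inv_mul_eq_div, le_div_iff₀ hx'] at h1
    have hfcont : Continuous f := continuous_pi fun i => by
      simpa only [hf] using (hg i).rexp
    have hlog : ContinuousOn (fun z : ι → ℝ => fun i => Real.log (z i)) K :=
      continuousOn_pi.2 fun i => (continuous_apply i).continuousOn.log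
        fun z hz => (hKpos hz i).ne'
    obtain ⟨R, hR⟩ := (hK.image_of_continuousOn hlog).isBounded.exists_norm_le
    choose C hC using fun i => (h i).bounded
    have hC0 : ∀ i, 0 ≤ C i := fun i => (abs_nonneg _).trans (hC i 0)
    have hbound : ∀ x ∈ f ⁻¹' K, ‖Φ x‖ ≤ R + ∑ i, C i := by
      intro x hx
      have hgR : ‖fun i => g i x‖ ≤ R := by
        simpa [hf] using hR _ ⟨f x, hx, rfl⟩
      refine (pi_norm_le_iff_of_nonneg
        (add_nonneg ((norm_nonneg _).trans hgR) (Finset.sum_nonneg fun i _ => hC0 i))).2 fun i => ?_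
      have h1 : |g i x| ≤ R := (norm_le_pi_norm (fun i => g i x) i).trans hgR
      have h2 : C i ≤ ∑ i, C i := Finset.single_le_sum (fun i _ => hC0 i) (Finset.mem_univ i)
      have h3 := hC i x
      rw [Real.norm_eq_abs, abs_le]
      rw [abs_le] at h1 h3
      constructor <;> linarith
    refine Metric.isCompact_of_isClosed_isBounded (hK.isClosed.preimage hfcont) ?_
    refine (Metric.isBounded_closedBall (x := (0 : E)) (r := (R + ∑ i, C i) / c)).subset ?_
    intro x hx
    rw [mem_closedBall_zero_iff, le_div_iff₀ hc, mul_comm]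
    exact (hclow x).trans (hbound x hx)

end HasRecession

/-- A coordinate that is positive somewhere on a nonnegative compact convex set is positive at some
extreme point. -/
theorem exists_extremePoint_pos_s8 {ι : Type*} [Fintype ι] {Q : Set (ι → ℝ)} (hQ : IsCompact Q)
    (hconv : Convex ℝ Q) {y : ι → ℝ} (hy : y ∈ Q) {j : ι} (hj : 0 < y j) :
    ∃ x ∈ Set.extremePoints ℝ Q, 0 < x j := by
  by_contra! hle
  have hsub : closure (convexHull ℝ (Set.extremePoints ℝ Q)) ⊆ {x | x j ≤ 0} := by
    refine closure_minimal (convexHull_min hle ?_)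
      (isClosed_le (continuous_apply j) continuous_const)
    exact convex_halfSpace_le (LinearMap.proj (R := ℝ) (φ := fun _ : ι => ℝ) j).isLinear 0
  rw [closure_convexHull_extremePoints hQ hconv] at hsub
  exact absurd (hsub hy) (not_le.2 hj)

theorem isCompact_setOf_mulVec_eq_zero {m l : Type*} [Fintype m] [Fintype l]
    (A : Matrix l m ℝ) :
    IsCompact {y : m → ℝ | A.mulVec y = 0 ∧ (∀ j, 0 ≤ y j) ∧ ∑ j, y j = 1} := by
  have : {y : m → ℝ | A.mulVec y = 0 ∧ (∀ j, 0 ≤ y j) ∧ ∑ j, y j = 1} =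
      stdSimplex ℝ m ∩ {y | A.mulVec y = 0} := by
    ext y; simp [stdSimplex, and_comm, and_assoc]
  rw [this]
  exact (isCompact_stdSimplex ℝ m).inter_right
    (isClosed_eq (Continuous.matrix_mulVec continuous_const continuous_id) continuous_const)

theorem convex_setOf_mulVec_eq_zero {m l : Type*} [Fintype m] [Fintype l]
    (A : Matrix l m ℝ) :
    Convex ℝ {y : m → ℝ | A.mulVec y = 0 ∧ (∀ j, 0 ≤ y j) ∧ ∑ j, y j = 1} := by
  have : {y : m → ℝ | A.mulVec y = 0 ∧ (∀ j, 0 ≤ y j) ∧ ∑ j, y j = 1} =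
      stdSimplex ℝ m ∩ (LinearMap.ker A.mulVecLin : Set (m → ℝ)) := by
    ext y; simp [stdSimplex, and_comm, and_assoc]
  rw [this]
  exact (convex_stdSimplex ℝ m).inter (Submodule.convex _)


/-- f is proper into the positive orthant iff the ray condition holds for every nonzero ξ. -/
theorem proper_iff_ray_condition
    (l m n dP d nP : ℕ)
    (A : Matrix (Fin l) (Fin m) ℝ) (B : Matrix (Fin n) (Fin m) ℝ)
    (T D : Submodule ℝ (Fin m → ℝ))
    (hT : ∀ y : Fin m → ℝ, y ∈ T ↔ (A.mulVec y = 0 ∧ ∑ j, y j = 0))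
    (hD : ∀ y : Fin m → ℝ, y ∈ D ↔ (B.mulVec y = 0 ∧ ∑ j, y j = 0))
    (hdP : Module.finrank ℝ T = dP) (hd : Module.finrank ℝ D = d) (hdPd : dP = d)
    (G : Matrix (Fin m) (Fin dP) ℝ) (H : Matrix (Fin m) (Fin d) ℝ)
    (hGind : LinearIndependent ℝ (fun i : Fin dP => fun j => G j i))
    (hGrange : LinearMap.range G.mulVecLin = T)
    (hHind : LinearIndependent ℝ (fun i : Fin d => fun j => H j i))
    (hHrange : LinearMap.range H.mulVecLin = D)
    (P : Set (Fin m → ℝ))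
    (hP : P = {y : Fin m → ℝ | A.mulVec y = 0 ∧ (∀ j, 0 < y j) ∧ ∑ j, y j = 1})
    (hPne : P.Nonempty)
    (Pbar : Set (Fin m → ℝ))
    (hPbar : Pbar = {y : Fin m → ℝ | A.mulVec y = 0 ∧ (∀ j, 0 ≤ y j) ∧ ∑ j, y j = 1})
    (v : Fin nP → (Fin m → ℝ))
    (hv : Set.range v = Set.extremePoints ℝ Pbar)
    (p : (Fin dP → ℝ) → (Fin m → ℝ))
    (hp : ∀ ξ, p ξ = (∑ k, Real.exp (∑ j, v k j * G.mulVec ξ j))⁻¹ •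
        ∑ k, Real.exp (∑ j, v k j * G.mulVec ξ j) • v k)
    (f : (Fin dP → ℝ) → (Fin d → ℝ))
    (hf : ∀ ξ, f ξ = fun i => ∏ j, Real.rpow (p ξ j) (H j i))
    :
    (∀ K ⊆ {z : Fin d → ℝ | ∀ i, 0 < z i}, IsCompact K → IsCompact (f ⁻¹' K)) ↔
    (∀ ξ : Fin dP → ℝ, ξ ≠ 0 → ∀ z : Fin d → ℝ,
      Filter.Tendsto (fun t : ℝ => f (t • ξ)) Filter.atTop (nhds z) →
      ((∀ i, 0 ≤ z i) ∧ ∃ i, z i = 0)) := by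
  have hvmem : ∀ k, v k ∈ Pbar := fun k => extremePoints_subset (hv ▸ Set.mem_range_self k)
  have hv0 : ∀ k j, 0 ≤ v k j := by
    intro k j
    have := hvmem k
    rw [hPbar] at this
    exact this.2.1 j
  obtain ⟨y, hy⟩ := hPne
  rw [hP] at hy
  have hvpos : ∀ j, ∃ k, 0 < v k j := by
    intro j
    obtain ⟨x, hx, hxj⟩ := exists_extremePoint_pos_s8 (Q := Pbar)
      (hPbar ▸ isCompact_setOf_mulVec_eq_zero A) (hPbar ▸ convex_setOf_mulVec_eq_zero A)
      (y := y) (by rw [hPbar]; exact ⟨hy.1, fun j => (hy.2.1 j).le, hy.2.2⟩) (hy.2.1 j)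
    rw [← hv] at hx
    obtain ⟨k, rfl⟩ := hx
    exact ⟨k, hxj⟩
  obtain ⟨k₀⟩ : Nonempty (Fin nP) := by
    rcases isEmpty_or_nonempty (Fin m) with hm | ⟨⟨j⟩⟩
    · simpa using hy.2.2
    · exact (hvpos j).nonempty
  set W : (Fin dP → ℝ) →L[ℝ] (Fin nP → ℝ) :=
    LinearMap.toContinuousLinearMap ((Matrix.of v).mulVecLin ∘ₗ G.mulVecLin) with hW
  have hWapply : ∀ ξ k, W ξ k = ∑ j, v k j * G.mulVec ξ j := fun ξ k => rfl
  have hden : ∀ ξ, 0 < ∑ k, Real.exp (W ξ k) := fun ξ =>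
    Finset.sum_pos (fun k _ => Real.exp_pos _) ⟨k₀, Finset.mem_univ k₀⟩
  have hnum : ∀ j ξ, 0 < ∑ k, v k j * Real.exp (W ξ k) := by
    intro j ξ
    obtain ⟨k, hk⟩ := hvpos j
    exact Finset.sum_pos' (fun k _ => mul_nonneg (hv0 k j) (Real.exp_pos _).le)
      ⟨k, Finset.mem_univ k, mul_pos hk (Real.exp_pos _)⟩
  have hpj : ∀ ξ j, p ξ j = (∑ k, v k j * Real.exp (W ξ k)) / ∑ k, Real.exp (W ξ k) := by
    intro ξ j
    rw [hp, Pi.smul_apply, Finset.sum_apply, smul_eq_mul, inv_mul_eq_div]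
    simp only [hWapply, Pi.smul_apply, smul_eq_mul, mul_comm (Real.exp _)]
  choose M hM using fun j =>
    HasRecession.exists_log_sum_exp (fun k => v k j) (fun k => hv0 k j) (hvpos j)
  obtain ⟨N, hN⟩ := HasRecession.exists_log_sum_exp (fun _ : Fin nP => (1 : ℝ))
    (fun _ => zero_le_one) ⟨k₀, one_pos⟩
  simp only [one_mul] at hN
  refine HasRecession.proper_iff
    (fun i => HasRecession.sum Finset.univ
      fun j => (((hM j).comp W).sub (hN.comp W)).const_mul (H j i)) (fun i => ?_) fun ξ i => ?_
  · refine continuous_finsetSum _ fun j _ => continuous_const.mul (Continuous.sub ?_ ?_)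
    · exact Continuous.log (by fun_prop) fun ξ => (hnum j ξ).ne'
    · exact Continuous.log (by fun_prop) fun ξ => (hden ξ).ne'
  · rw [hf, Real.exp_sum]
    refine Finset.prod_congr rfl fun j _ => ?_
    rw [hpj, Real.rpow_eq_pow, Real.rpow_def_of_pos (div_pos (hnum j ξ) (hden ξ)),
      Real.log_div (hnum j ξ).ne' (hden ξ).ne', mul_comm]
end

section
/- The map f is proper as a map into {z ∈ ℝ^d : z > 0} if and only if for every nonzero ξ ∈ ℝ^{d_P} there exists i ∈ {1, …, d} such that Σ_{j=1}^m μ_j^max(Gξ) · H_{ji} ≠ 0. -/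
/-- The logarithm of a weighted sum of exponentials stays within bounded distance of the largest
exponent carrying a nonzero weight. -/
theorem exists_abs_log_sum_exp_sub_le {ι : Type*} [Fintype ι] (w : ι → ℝ) (hw : ∀ k, 0 ≤ w k) :
    ∃ C : ℝ, ∀ (a : ι → ℝ) (M : ℝ), IsGreatest {x : ℝ | ∃ k, w k ≠ 0 ∧ x = a k} M →
      |Real.log (∑ k, Real.exp (a k) * w k) - M| ≤ C := by
  refine ⟨∑ k, |Real.log (w k)| + |Real.log (∑ k, w k)|, fun a M hM => ?_⟩
  obtain ⟨⟨k₀, hk₀, rfl⟩, hub⟩ := hM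
  have hpos : 0 < w k₀ := (hw k₀).lt_of_ne' hk₀
  have hlow : Real.exp (a k₀) * w k₀ ≤ ∑ k, Real.exp (a k) * w k :=
    Finset.single_le_sum (f := fun k => Real.exp (a k) * w k)
      (fun k _ => mul_nonneg (Real.exp_pos _).le (hw k)) (Finset.mem_univ k₀)
  have hupp : ∑ k, Real.exp (a k) * w k ≤ Real.exp (a k₀) * ∑ k, w k := by
    rw [Finset.mul_sum]
    refine Finset.sum_le_sum fun k _ => ?_
    by_cases hk : w k = 0
    · simp [hk]
    · exact mul_le_mul_of_nonneg_right (Real.exp_le_exp.2 (hub ⟨k, hk, rfl⟩)) (hw k)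
  have hsum : 0 < ∑ k, w k :=
    hpos.trans_le (Finset.single_le_sum (fun k _ => hw k) (Finset.mem_univ k₀))
  have hprod : 0 < Real.exp (a k₀) * w k₀ := by positivity
  have h₁ := Real.log_le_log hprod hlow
  have h₂ := Real.log_le_log (hprod.trans_le hlow) hupp
  rw [Real.log_mul (Real.exp_pos _).ne' hpos.ne', Real.log_exp] at h₁
  rw [Real.log_mul (Real.exp_pos _).ne' hsum.ne', Real.log_exp] at h₂
  have h₃ : |Real.log (w k₀)| ≤ ∑ k, |Real.log (w k)| :=
    Finset.single_le_sum (f := fun k => |Real.log (w k)|)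
      (fun k _ => abs_nonneg _) (Finset.mem_univ k₀)
  have h₄ := neg_abs_le (Real.log (w k₀))
  have h₅ := le_abs_self (Real.log (∑ k, w k))
  have h₆ := abs_nonneg (Real.log (∑ k, w k))
  have h₇ := abs_nonneg (Real.log (w k₀))
  rw [abs_le]
  constructor <;> linarith

/-- A continuous positively homogeneous map on a finite-dimensional space that vanishes only at
the origin grows at least linearly. -/
theorem exists_pos_mul_norm_le_of_homogeneous {E E' : Type*} [NormedAddCommGroup E]
    [NormedSpace ℝ E] [ProperSpace E] [NormedAddCommGroup E'] [NormedSpace ℝ E']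
    {F : E → E'} (hF : Continuous F) (hhom : ∀ (t : ℝ) (x : E), 0 ≤ t → F (t • x) = t • F x)
    (hne : ∀ x, x ≠ 0 → F x ≠ 0) : ∃ c > 0, ∀ x, c * ‖x‖ ≤ ‖F x‖ := by
  rcases (Metric.sphere (0 : E) 1).eq_empty_or_nonempty with hS | hS
  · refine ⟨1, one_pos, fun x => ?_⟩
    have hx : x = 0 := by
      by_contra hx
      have : ‖x‖⁻¹ • x ∈ Metric.sphere (0 : E) 1 := by
        simp [norm_smul, norm_ne_zero_iff.2 hx]
      simp [hS] at this
    simp [hx]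
  · obtain ⟨x₀, hx₀, hmin⟩ := (isCompact_sphere (0 : E) 1).exists_isMinOn hS hF.norm.continuousOn
    have hx₀' : x₀ ≠ 0 := by
      rintro rfl
      simp at hx₀
    refine ⟨‖F x₀‖, norm_pos_iff.2 (hne x₀ hx₀'), fun x => ?_⟩
    by_cases hx : x = 0
    · simp [hx]
    · have hn : 0 < ‖x‖ := norm_pos_iff.2 hx
      have hle : ‖F x₀‖ ≤ ‖F (‖x‖⁻¹ • x)‖ :=
        hmin (show ‖x‖⁻¹ • x ∈ Metric.sphere (0 : E) 1 by simp [norm_smul, hn.ne'])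
      rw [hhom _ _ (inv_nonneg.2 hn.le), norm_smul, norm_inv, norm_norm] at hle
      calc ‖F x₀‖ * ‖x‖ ≤ ‖x‖⁻¹ * ‖F x‖ * ‖x‖ := mul_le_mul_of_nonneg_right hle hn.le
        _ = ‖F x‖ := by field_simp

/-- If `log ∘ f` is within bounded distance of a continuous positively homogeneous map `F`, then
`f` is proper into the positive orthant iff `F` vanishes only at the origin. -/
theorem proper_iff_of_abs_log_sub_le {E ι : Type*} [NormedAddCommGroup E]
    [NormedSpace ℝ E] [ProperSpace E] [Fintype ι] {f F : E → ι → ℝ}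
    (hf : Continuous f) (hpos : ∀ x i, 0 < f x i)
    (hF : Continuous F) (hhom : ∀ (t : ℝ) (x : E), 0 ≤ t → F (t • x) = t • F x)
    {C : ℝ} (hC : ∀ x i, |Real.log (f x i) - F x i| ≤ C) :
    (∀ K ⊆ {z : ι → ℝ | ∀ i, 0 < z i}, IsCompact K → IsCompact (f ⁻¹' K)) ↔
      ∀ x, x ≠ 0 → F x ≠ 0 := by
  constructor
  · intro hK x hx hFx
    have hcomp := hK (Set.Icc (fun _ => Real.exp (-C)) (fun _ => Real.exp C))
      (fun z hz i => (Real.exp_pos _).trans_le (hz.1 i)) isCompact_Icc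
    obtain ⟨R, hR⟩ := hcomp.isBounded.exists_norm_le
    have hmem : ∀ t : ℝ, 0 ≤ t →
        t • x ∈ f ⁻¹' Set.Icc (fun _ => Real.exp (-C)) (fun _ => Real.exp C) := by
      intro t ht
      have hb : ∀ i, -C ≤ Real.log (f (t • x) i) ∧ Real.log (f (t • x) i) ≤ C := fun i => by
        have h := hC (t • x) i
        rw [hhom t x ht, hFx, smul_zero, Pi.zero_apply, sub_zero] at h
        exact abs_le.1 h
      exact ⟨fun i => (Real.le_log_iff_exp_le (hpos _ i)).1 (hb i).1,
        fun i => (Real.log_le_iff_le_exp (hpos _ i)).1 (hb i).2⟩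
    have hn : 0 < ‖x‖ := norm_pos_iff.2 hx
    have hle := hR _ (hmem ((|R| + 1) / ‖x‖) (by positivity))
    rw [norm_smul, Real.norm_of_nonneg (by positivity), div_mul_cancel₀ _ hn.ne'] at hle
    linarith [le_abs_self R]
  · intro hne K hKpos hK
    obtain ⟨c, hc, hcF⟩ := exists_pos_mul_norm_le_of_homogeneous hF hhom hne
    have hlog : ContinuousOn (fun (z : ι → ℝ) i => Real.log (z i)) K :=
      continuousOn_pi.2 fun i =>
        (continuous_apply i).continuousOn.log fun z hz => (hKpos hz i).ne'
    obtain ⟨M, hM⟩ := (hK.image_of_continuousOn hlog).isBounded.exists_norm_le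
    refine Metric.isCompact_of_isClosed_isBounded (hK.isClosed.preimage hf) ?_
    refine isBounded_iff_forall_norm_le.2 ⟨(|M| + |C|) / c, fun x hx => ?_⟩
    rw [le_div_iff₀ hc, mul_comm]
    refine (hcF x).trans ((pi_norm_le_iff_of_nonneg (by positivity)).2 fun i => ?_)
    have h₁ : |Real.log (f x i)| ≤ M :=
      (norm_le_pi_norm (fun i => Real.log (f x i)) i).trans (hM _ ⟨f x, hx, rfl⟩)
    have h₂ := hC x i
    rw [Real.norm_eq_abs]
    rw [abs_le] at h₁ h₂ ⊢
    constructor <;> linarith [le_abs_self M, le_abs_self C]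

/-- The pointwise maximum of finitely many linear forms is continuous. -/
theorem continuous_of_isGreatest_linear {ι κ : Type*} [Finite ι] [Fintype κ] {v : ι → κ → ℝ}
    {S : ι → Prop} {μ : (κ → ℝ) → ℝ}
    (hμ : ∀ t, IsGreatest {x : ℝ | ∃ k, S k ∧ x = ∑ j, v k j * t j} (μ t)) :
    Continuous μ := by
  classical
  have := Fintype.ofFinite ι
  obtain ⟨k₀, hk₀, -⟩ := (hμ 0).1
  have hne : (Finset.univ.filter S).Nonempty := ⟨k₀, by simpa using hk₀⟩
  have heq : μ = fun t => (Finset.univ.filter S).sup' hne fun k => ∑ j, v k j * t j := by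
    funext t
    obtain ⟨⟨k, hk, hkt⟩, hub⟩ := hμ t
    refine le_antisymm ?_ (Finset.sup'_le _ _ fun k' hk' => hub ⟨k', by simpa using hk', rfl⟩)
    rw [hkt]
    exact Finset.le_sup' (fun k => ∑ j, v k j * t j) (by simpa using hk)
  rw [heq]
  exact Continuous.finset_sup'_apply hne fun k _ => by fun_prop

/-- The pointwise maximum of finitely many linear forms is positively homogeneous. -/
theorem smul_of_isGreatest_linear {ι κ : Type*} [Fintype κ] {v : ι → κ → ℝ}
    {S : ι → Prop} {μ : (κ → ℝ) → ℝ}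
    (hμ : ∀ t, IsGreatest {x : ℝ | ∃ k, S k ∧ x = ∑ j, v k j * t j} (μ t))
    {r : ℝ} (hr : 0 ≤ r) (t : κ → ℝ) : μ (r • t) = r * μ t := by
  have hlin : ∀ k, ∑ j, v k j * (r • t) j = r * ∑ j, v k j * t j := fun k => by
    rw [Finset.mul_sum]
    exact Finset.sum_congr rfl fun j _ => by simp only [Pi.smul_apply, smul_eq_mul]; ring
  obtain ⟨k, hk, hkt⟩ := (hμ t).1
  refine (hμ (r • t)).unique ⟨⟨k, hk, by rw [hlin, hkt]⟩, ?_⟩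
  rintro _ ⟨k', hk', rfl⟩
  rw [hlin]
  exact mul_le_mul_of_nonneg_left ((hμ t).2 ⟨k', hk', rfl⟩) hr


/-- f is proper iff for every nonzero ξ there is i with ∑ⱼ μⱼᵐᵃˣ(Gξ) Hⱼᵢ ≠ 0. -/
theorem proper_first_characterization
    (l m n dP d nP : ℕ)
    (A : Matrix (Fin l) (Fin m) ℝ) (B : Matrix (Fin n) (Fin m) ℝ)
    (T D : Submodule ℝ (Fin m → ℝ))
    (hT : ∀ y : Fin m → ℝ, y ∈ T ↔ (A.mulVec y = 0 ∧ ∑ j, y j = 0))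
    (hD : ∀ y : Fin m → ℝ, y ∈ D ↔ (B.mulVec y = 0 ∧ ∑ j, y j = 0))
    (hdP : Module.finrank ℝ T = dP) (hd : Module.finrank ℝ D = d) (hdPd : dP = d)
    (G : Matrix (Fin m) (Fin dP) ℝ) (H : Matrix (Fin m) (Fin d) ℝ)
    (hGind : LinearIndependent ℝ (fun i : Fin dP => fun j => G j i))
    (hGrange : LinearMap.range G.mulVecLin = T)
    (hHind : LinearIndependent ℝ (fun i : Fin d => fun j => H j i))
    (hHrange : LinearMap.range H.mulVecLin = D)
    (P : Set (Fin m → ℝ))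
    (hP : P = {y : Fin m → ℝ | A.mulVec y = 0 ∧ (∀ j, 0 < y j) ∧ ∑ j, y j = 1})
    (hPne : P.Nonempty)
    (Pbar : Set (Fin m → ℝ))
    (hPbar : Pbar = {y : Fin m → ℝ | A.mulVec y = 0 ∧ (∀ j, 0 ≤ y j) ∧ ∑ j, y j = 1})
    (v : Fin nP → (Fin m → ℝ))
    (hv : Set.range v = Set.extremePoints ℝ Pbar)
    (μmax : (Fin m → ℝ) → (Fin m → ℝ))
    (hμ : ∀ (t : Fin m → ℝ) (j : Fin m),
      IsGreatest {x : ℝ | ∃ k, v k j ≠ 0 ∧ x = ∑ j', v k j' * t j'} (μmax t j))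
    (p : (Fin dP → ℝ) → (Fin m → ℝ))
    (hp : ∀ ξ, p ξ = (∑ k, Real.exp (∑ j, v k j * G.mulVec ξ j))⁻¹ •
        ∑ k, Real.exp (∑ j, v k j * G.mulVec ξ j) • v k)
    (f : (Fin dP → ℝ) → (Fin d → ℝ))
    (hf : ∀ ξ, f ξ = fun i => ∏ j, Real.rpow (p ξ j) (H j i))
    :
    (∀ K ⊆ {z : Fin d → ℝ | ∀ i, 0 < z i}, IsCompact K → IsCompact (f ⁻¹' K)) ↔
    (∀ ξ : Fin dP → ℝ, ξ ≠ 0 → ∃ i : Fin d, ∑ j, μmax (G.mulVec ξ) j * H j i ≠ 0) := by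
  have hvnn : ∀ k j, 0 ≤ v k j := fun k j => by
    have hk : v k ∈ Pbar := extremePoints_subset (hv ▸ Set.mem_range_self k)
    rw [hPbar] at hk
    exact hk.2.1 j
  have hHsum : ∀ i, ∑ j, H j i = 0 := fun i => by
    have hi : H.mulVec (Pi.single i 1) ∈ D := hHrange ▸ ⟨Pi.single i 1, rfl⟩
    simpa using ((hD _).1 hi).2
  set Z : (Fin dP → ℝ) → ℝ := fun ξ => ∑ k, Real.exp (∑ j, v k j * G.mulVec ξ j)
  set q : (Fin dP → ℝ) → Fin m → ℝ :=
    fun ξ j => ∑ k, Real.exp (∑ j', v k j' * G.mulVec ξ j') * v k j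
  have hpq : ∀ ξ j, p ξ j = (Z ξ)⁻¹ * q ξ j := fun ξ j => by
    simp [hp, Z, q, Finset.sum_apply]
  have hqpos : ∀ ξ j, 0 < q ξ j := fun ξ j => by
    obtain ⟨k, hk, -⟩ := (hμ 0 j).1
    exact Finset.sum_pos' (fun k _ => mul_nonneg (Real.exp_pos _).le (hvnn k j))
      ⟨k, Finset.mem_univ k, mul_pos (Real.exp_pos _) ((hvnn k j).lt_of_ne' hk)⟩
  have hGc : Continuous fun ξ => G.mulVec ξ := G.mulVecLin.continuous_of_finiteDimensional
  have hZpos : ∀ ξ, 0 < Z ξ := fun ξ => by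
    obtain ⟨y, hy⟩ := hPne
    rw [hP] at hy
    obtain ⟨j⟩ : Nonempty (Fin m) := by
      by_contra h
      rw [not_nonempty_iff] at h
      simpa using hy.2.2
    obtain ⟨k, -, -⟩ := (hμ 0 j).1
    exact Finset.sum_pos (fun k _ => Real.exp_pos _) ⟨k, Finset.mem_univ k⟩
  have hppos : ∀ ξ j, 0 < p ξ j := fun ξ j => by
    rw [hpq]
    exact mul_pos (inv_pos.2 (hZpos ξ)) (hqpos ξ j)
  have hpc : ∀ j, Continuous fun ξ => p ξ j := fun j => by
    have hexp : ∀ k, Continuous fun ξ => Real.exp (∑ j', v k j' * G.mulVec ξ j') := fun k =>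
      Real.continuous_exp.comp (continuous_finsetSum _ fun j' _ =>
        continuous_const.mul ((continuous_apply j').comp hGc))
    simp only [hpq]
    exact ((continuous_finsetSum _ fun k _ => hexp k).inv₀ fun ξ => (hZpos ξ).ne').mul
      (continuous_finsetSum _ fun k _ => (hexp k).mul continuous_const)
  have hfpos : ∀ ξ i, 0 < f ξ i := fun ξ i => by
    rw [hf]
    exact Finset.prod_pos fun j _ => Real.rpow_pos_of_pos (hppos ξ j) _
  have hfc : Continuous f := by
    refine continuous_pi fun i => ?_
    simp only [hf]
    exact continuous_finsetProd _ fun j _ =>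
      (hpc j).rpow_const fun ξ => Or.inl (hppos ξ j).ne'
  have hlogf : ∀ ξ i, Real.log (f ξ i) = ∑ j, Real.log (q ξ j) * H j i := fun ξ i => by
    have hterm : ∀ j, Real.log (Real.rpow (p ξ j) (H j i)) =
        -Real.log (Z ξ) * H j i + Real.log (q ξ j) * H j i := fun j => by
      rw [Real.rpow_eq_pow, Real.log_rpow (hppos ξ j), hpq,
        Real.log_mul (inv_pos.2 (hZpos ξ)).ne' (hqpos ξ j).ne', Real.log_inv]
      ring
    have hprod : Real.log (∏ j, Real.rpow (p ξ j) (H j i)) =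
        ∑ j, Real.log (Real.rpow (p ξ j) (H j i)) :=
      Real.log_prod fun j _ => (Real.rpow_pos_of_pos (hppos ξ j) _).ne'
    rw [congrFun (hf ξ) i, hprod]
    simp only [hterm, Finset.sum_add_distrib, ← Finset.mul_sum, hHsum, mul_zero, zero_add]
  choose C hC using fun j => exists_abs_log_sum_exp_sub_le (fun k => v k j) fun k => hvnn k j
  have hbound : ∀ ξ i, |Real.log (f ξ i) - ∑ j, μmax (G.mulVec ξ) j * H j i| ≤
      ∑ i, ∑ j, |C j| * |H j i| := fun ξ i => by
    rw [hlogf, ← Finset.sum_sub_distrib]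
    refine (Finset.abs_sum_le_sum_abs _ _).trans ((Finset.sum_le_sum fun j _ => ?_).trans
      (Finset.single_le_sum (f := fun i => ∑ j, |C j| * |H j i|)
        (fun i _ => by positivity) (Finset.mem_univ i)))
    rw [← sub_mul, abs_mul]
    exact mul_le_mul_of_nonneg_right ((hC j _ _ (hμ (G.mulVec ξ) j)).trans (le_abs_self _))
      (abs_nonneg _)
  have hFc : Continuous fun ξ (i : Fin d) => ∑ j, μmax (G.mulVec ξ) j * H j i :=
    continuous_pi fun i => continuous_finsetSum _ fun j _ =>
      ((continuous_of_isGreatest_linear fun t => hμ t j).comp hGc).mul continuous_const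
  rw [proper_iff_of_abs_log_sub_le hfc hfpos hFc (fun t ξ ht => ?_) hbound]
  · simp only [Function.ne_iff, Pi.zero_apply]
  · funext i
    rw [Pi.smul_apply, smul_eq_mul, Finset.mul_sum]
    refine Finset.sum_congr rfl fun j _ => ?_
    rw [Matrix.mulVec_smul, smul_of_isGreatest_linear (fun s => hμ s j) ht, mul_assoc]
end

section
/- The map f is not proper as a map into {z ∈ ℝ^d : z > 0} if and only if there exists a nonzero t ∈ T such that μ^max(t) ∈ D^⊥. -/
open Set Real

/-- A weighted sum of exponentials agrees with its largest exponent, up to a logarithmic error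
that does not depend on the exponents. -/
theorem abs_log_sum_exp_mul_sub_le {ι : Type*} [Fintype ι] (w a : ι → ℝ) (hw : ∀ k, 0 ≤ w k)
    {M : ℝ} (hM : IsGreatest {x : ℝ | ∃ k, w k ≠ 0 ∧ x = a k} M) :
    0 < ∑ k, exp (a k) * w k ∧
      |log (∑ k, exp (a k) * w k) - M| ≤ |log (∑ k, w k)| + ∑ k, |log (w k)| := by
  obtain ⟨⟨k₀, hk₀, rfl⟩, hub⟩ := hM
  have hk₀pos : 0 < w k₀ := lt_of_le_of_ne (hw k₀) hk₀.symm
  have lower : exp (a k₀) * w k₀ ≤ ∑ k, exp (a k) * w k :=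
    Finset.single_le_sum (f := fun k => exp (a k) * w k)
      (fun k _ => mul_nonneg (exp_pos _).le (hw k)) (Finset.mem_univ k₀)
  have upper : ∑ k, exp (a k) * w k ≤ exp (a k₀) * ∑ k, w k := by
    rw [Finset.mul_sum]
    refine Finset.sum_le_sum fun k _ => ?_
    by_cases hk : w k = 0
    · simp [hk]
    · exact mul_le_mul_of_nonneg_right (exp_le_exp.2 (hub ⟨k, hk, rfl⟩)) (hw k)
  have hwsum : 0 < ∑ k, w k :=
    hk₀pos.trans_le (Finset.single_le_sum (fun k _ => hw k) (Finset.mem_univ k₀))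
  have hleft : 0 < exp (a k₀) * w k₀ := by positivity
  have hsum := hleft.trans_le lower
  refine ⟨hsum, ?_⟩
  have loglower := log_le_log hleft lower
  have logupper := log_le_log hsum upper
  rw [log_mul (exp_ne_zero _) hk₀, log_exp] at loglower
  rw [log_mul (exp_ne_zero _) hwsum.ne', log_exp] at logupper
  have hsingle : |log (w k₀)| ≤ ∑ k, |log (w k)| :=
    Finset.single_le_sum (f := fun k => |log (w k)|) (fun k _ => abs_nonneg _)
      (Finset.mem_univ k₀)
  have h1 := neg_abs_le (log (w k₀))
  have h2 := le_abs_self (log (∑ k, w k))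
  have h3 := abs_nonneg (log (∑ k, w k))
  have h4 := abs_nonneg (log (w k₀))
  rw [abs_le]
  constructor <;> linarith

/-- A pointwise maximum of a finite family of continuous functions is continuous. -/
theorem continuous_of_isGreatest {ι X : Type*} [Finite ι] [TopologicalSpace X] [Nonempty X]
    (q : ι → Prop) (a : ι → X → ℝ) (ha : ∀ k, Continuous (a k)) (M : X → ℝ)
    (hM : ∀ x, IsGreatest {y : ℝ | ∃ k, q k ∧ y = a k x} (M x)) : Continuous M := by
  classical
  have := Fintype.ofFinite ι
  obtain ⟨⟨k₀, hk₀, -⟩, -⟩ := hM (Classical.arbitrary X)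
  have hne : (Finset.univ.filter q).Nonempty := ⟨k₀, by simpa using hk₀⟩
  have hsup : M = fun x => (Finset.univ.filter q).sup' hne fun k => a k x := by
    funext x
    obtain ⟨⟨k, hk, hMk⟩, hub⟩ := hM x
    apply le_antisymm
    · rw [hMk]
      exact Finset.le_sup' (fun k => a k x) (by simpa using hk)
    · exact Finset.sup'_le _ _ fun k hk => hub ⟨k, by simpa using hk, rfl⟩
  rw [hsup]
  exact Continuous.finset_sup'_apply hne fun k _ => ha k

/-- A positive continuous map whose logarithm is at bounded distance from a continuous positively
homogeneous map `F` is proper into the positive orthant iff `F` vanishes only at the origin. -/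
theorem not_proper_iff_exists_zero_of_log_asymptotic {E κ : Type*} [NormedAddCommGroup E]
    [NormedSpace ℝ E] [FiniteDimensional ℝ E] [Fintype κ]
    {f F : E → κ → ℝ} (hfc : Continuous f) (hpos : ∀ ξ i, 0 < f ξ i) (hFc : Continuous F)
    (hhom : ∀ s : ℝ, 0 < s → ∀ ξ, F (s • ξ) = s • F ξ)
    {C : ℝ} (hC : ∀ ξ i, |log (f ξ i) - F ξ i| ≤ C) :
    ¬ (∀ K ⊆ {z : κ → ℝ | ∀ i, 0 < z i}, IsCompact K → IsCompact (f ⁻¹' K)) ↔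
      ∃ ξ, ξ ≠ 0 ∧ F ξ = 0 := by
  have := FiniteDimensional.proper_real E
  constructor
  · contrapose!
    intro hF K hKpos hK
    obtain ⟨c, hc, hcF⟩ := (isCompact_sphere (0 : E) 1).exists_forall_le' (a := 0)
      (f := fun ξ => ‖F ξ‖) hFc.norm.continuousOn
      (fun ξ hξ => norm_pos_iff.2 (hF ξ (ne_zero_of_mem_unit_sphere ⟨ξ, hξ⟩)))
    have hlog : ContinuousOn (fun (z : κ → ℝ) i => log (z i)) K :=
      continuousOn_pi.2 fun i => (continuous_apply i).continuousOn.log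
        fun z hz => (hKpos hz i).ne'
    obtain ⟨R, hR⟩ := hK.exists_bound_of_continuousOn hlog
    refine Metric.isCompact_of_isClosed_isBounded (hK.isClosed.preimage hfc) ?_
    refine isBounded_iff_forall_norm_le.2 ⟨(|R| + |C|) / c, fun ξ hξ => ?_⟩
    have hFle : ‖F ξ‖ ≤ |R| + |C| := by
      refine (pi_norm_le_iff_of_nonneg (by positivity)).2 fun i => ?_
      have h1 := (norm_le_pi_norm _ i).trans (hR _ hξ)
      have h2 := hC ξ i
      rw [Real.norm_eq_abs] at h1 ⊢
      rw [abs_le] at h1 h2 ⊢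
      constructor <;> linarith [le_abs_self R, le_abs_self C]
    rw [le_div_iff₀ hc]
    rcases eq_or_ne ξ 0 with rfl | hξ0
    · simp only [norm_zero, zero_mul]
      positivity
    · have hn : 0 < ‖ξ‖ := norm_pos_iff.2 hξ0
      have h := hcF (‖ξ‖⁻¹ • ξ) (by simp [norm_smul, hn.ne'])
      rw [hhom _ (inv_pos.2 hn), norm_smul, norm_inv, norm_norm, inv_mul_eq_div,
        le_div_iff₀ hn] at h
      linarith
  · rintro ⟨ξ, hξ, hFξ⟩ hproper
    have hbdd := (hproper (Icc (fun _ => exp (-C)) fun _ => exp C)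
      (fun z hz i => (exp_pos _).trans_le (hz.1 i)) isCompact_Icc).isBounded
    obtain ⟨R, hR⟩ := isBounded_iff_forall_norm_le.1 hbdd
    have hn : 0 < ‖ξ‖ := norm_pos_iff.2 hξ
    have hs : 0 < (|R| + 1) / ‖ξ‖ := by positivity
    have hbound : ∀ i, |log (f (((|R| + 1) / ‖ξ‖) • ξ) i)| ≤ C := fun i => by
      simpa [hhom _ hs, hFξ] using hC (((|R| + 1) / ‖ξ‖) • ξ) i
    have h := hR (((|R| + 1) / ‖ξ‖) • ξ)
      ⟨fun i => (le_log_iff_exp_le (hpos _ i)).1 (abs_le.1 (hbound i)).1,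
        fun i => (log_le_iff_le_exp (hpos _ i)).1 (abs_le.1 (hbound i)).2⟩
    rw [norm_smul, Real.norm_of_nonneg hs.le, div_mul_cancel₀ _ hn.ne'] at h
    linarith [le_abs_self R]


/-- f is not proper iff there is a nonzero t ∈ T with μᵐᵃˣ(t) ∈ D⊥. -/
theorem not_proper_iff
    (l m n dP d nP : ℕ)
    (A : Matrix (Fin l) (Fin m) ℝ) (B : Matrix (Fin n) (Fin m) ℝ)
    (T D : Submodule ℝ (Fin m → ℝ))
    (hT : ∀ y : Fin m → ℝ, y ∈ T ↔ (A.mulVec y = 0 ∧ ∑ j, y j = 0))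
    (hD : ∀ y : Fin m → ℝ, y ∈ D ↔ (B.mulVec y = 0 ∧ ∑ j, y j = 0))
    (hdP : Module.finrank ℝ T = dP) (hd : Module.finrank ℝ D = d) (hdPd : dP = d)
    (G : Matrix (Fin m) (Fin dP) ℝ) (H : Matrix (Fin m) (Fin d) ℝ)
    (hGind : LinearIndependent ℝ (fun i : Fin dP => fun j => G j i))
    (hGrange : LinearMap.range G.mulVecLin = T)
    (hHind : LinearIndependent ℝ (fun i : Fin d => fun j => H j i))
    (hHrange : LinearMap.range H.mulVecLin = D)
    (Dperp : Set (Fin m → ℝ))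
    (hDperp : Dperp = {u : Fin m → ℝ | ∀ z ∈ D, ∑ j, z j * u j = 0})
    (P : Set (Fin m → ℝ))
    (hP : P = {y : Fin m → ℝ | A.mulVec y = 0 ∧ (∀ j, 0 < y j) ∧ ∑ j, y j = 1})
    (hPne : P.Nonempty)
    (Pbar : Set (Fin m → ℝ))
    (hPbar : Pbar = {y : Fin m → ℝ | A.mulVec y = 0 ∧ (∀ j, 0 ≤ y j) ∧ ∑ j, y j = 1})
    (v : Fin nP → (Fin m → ℝ))
    (hv : Set.range v = Set.extremePoints ℝ Pbar)
    (μmax : (Fin m → ℝ) → (Fin m → ℝ))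
    (hμ : ∀ (t : Fin m → ℝ) (j : Fin m),
      IsGreatest {x : ℝ | ∃ k, v k j ≠ 0 ∧ x = ∑ j', v k j' * t j'} (μmax t j))
    (p : (Fin dP → ℝ) → (Fin m → ℝ))
    (hp : ∀ ξ, p ξ = (∑ k, Real.exp (∑ j, v k j * G.mulVec ξ j))⁻¹ •
        ∑ k, Real.exp (∑ j, v k j * G.mulVec ξ j) • v k)
    (f : (Fin dP → ℝ) → (Fin d → ℝ))
    (hf : ∀ ξ, f ξ = fun i => ∏ j, Real.rpow (p ξ j) (H j i))
    :
    ¬ (∀ K ⊆ {z : Fin d → ℝ | ∀ i, 0 < z i}, IsCompact K → IsCompact (f ⁻¹' K)) ↔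
    (∃ t ∈ T, t ≠ 0 ∧ μmax t ∈ Dperp) := by
  have hvPbar : ∀ k, v k ∈ Pbar := fun k => by
    have : v k ∈ Set.extremePoints ℝ Pbar := hv ▸ Set.mem_range_self k
    exact this.1
  have hvnn : ∀ k j, 0 ≤ v k j := fun k => by
    have := hvPbar k
    rw [hPbar] at this
    exact this.2.1
  have hm : Nonempty (Fin m) := by
    obtain ⟨y, hy⟩ := hPne
    rw [hP] at hy
    by_contra hempty
    rw [not_nonempty_iff] at hempty
    simpa using hy.2.2
  have hnP : Nonempty (Fin nP) := by
    obtain ⟨⟨k, -⟩, -⟩ := hμ 0 hm.some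
    exact ⟨k⟩
  have hHsum : ∀ i, ∑ j, H j i = 0 := fun i => by
    have hmem : H.mulVecLin (Pi.single i 1) ∈ D := hHrange ▸ LinearMap.mem_range_self _ _
    simpa using ((hD _).1 hmem).2
  have hμcont : Continuous μmax := continuous_pi fun j =>
    continuous_of_isGreatest (fun k => v k j ≠ 0) (fun k t => ∑ j', v k j' * t j')
      (fun k => by fun_prop) _ fun t => hμ t j
  have hμhom : ∀ s : ℝ, 0 < s → ∀ t, μmax (s • t) = s • μmax t := fun s hs t => by
    funext j
    refine (hμ (s • t) j).unique ?_
    have hscale : ∀ k, ∑ j', v k j' * (s • t) j' = s * ∑ j', v k j' * t j' := fun k => by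
      rw [Finset.mul_sum]
      exact Finset.sum_congr rfl fun j' _ => by simp only [Pi.smul_apply, smul_eq_mul]; ring
    obtain ⟨⟨k, hk, hkt⟩, hub⟩ := hμ t j
    refine ⟨⟨k, hk, by rw [hscale, ← hkt]; rfl⟩, ?_⟩
    rintro _ ⟨k', hk', rfl⟩
    rw [hscale]
    exact mul_le_mul_of_nonneg_left (hub ⟨k', hk', rfl⟩) hs.le
  have hmul : Continuous fun ξ => G.mulVec ξ := G.mulVecLin.continuous_of_finiteDimensional
  have hlse := fun ξ j => abs_log_sum_exp_mul_sub_le (fun k => v k j)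
    (fun k => ∑ j', v k j' * G.mulVec ξ j') (fun k => hvnn k j) (hμ (G.mulVec ξ) j)
  have hZ : ∀ ξ, 0 < ∑ k, exp (∑ j, v k j * G.mulVec ξ j) := fun ξ =>
    Finset.sum_pos (fun k _ => exp_pos _) Finset.univ_nonempty
  have hpj : ∀ ξ j, p ξ j = (∑ k, exp (∑ j, v k j * G.mulVec ξ j))⁻¹ *
      ∑ k, exp (∑ j, v k j * G.mulVec ξ j) * v k j := fun ξ j => by
    simp [hp, Finset.sum_apply]
  have hppos : ∀ ξ j, 0 < p ξ j := fun ξ j => by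
    rw [hpj]
    exact mul_pos (inv_pos.2 (hZ ξ)) (hlse ξ j).1
  have hpc : ∀ j, Continuous fun ξ => p ξ j := fun j => by
    simp only [hpj]
    have hexp : ∀ k, Continuous fun ξ => exp (∑ j, v k j * G.mulVec ξ j) := fun k => by
      fun_prop
    exact ((continuous_finsetSum _ fun k _ => hexp k).inv₀ fun ξ => (hZ ξ).ne').mul
      (continuous_finsetSum _ fun k _ => (hexp k).mul continuous_const)
  have hfc : Continuous f := continuous_pi fun i => by
    simp only [hf]
    exact continuous_finsetProd _ fun j _ =>
      (hpc j).rpow_const fun ξ => Or.inl (hppos ξ j).ne'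
  have hfpos : ∀ ξ i, 0 < f ξ i := fun ξ i => by
    rw [hf]
    exact Finset.prod_pos fun j _ => rpow_pos_of_pos (hppos ξ j) _
  have hlogf : ∀ ξ i, log (f ξ i) =
      ∑ j, H j i * log (∑ k, exp (∑ j, v k j * G.mulVec ξ j) * v k j) := fun ξ i => by
    have hterm : ∀ j, log ((p ξ j).rpow (H j i)) =
        H j i * log (∑ k, exp (∑ j, v k j * G.mulVec ξ j) * v k j) -
          H j i * log (∑ k, exp (∑ j, v k j * G.mulVec ξ j)) := fun j => by
      refine (log_rpow (hppos ξ j) _).trans ?_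
      rw [hpj, log_mul (inv_ne_zero (hZ ξ).ne') (hlse ξ j).1.ne', log_inv]
      ring
    rw [hf]
    refine (log_prod fun j _ => (rpow_pos_of_pos (hppos ξ j) (H j i)).ne').trans ?_
    refine (Finset.sum_congr rfl fun j _ => hterm j).trans ?_
    rw [Finset.sum_sub_distrib, ← Finset.sum_mul,
      hHsum, zero_mul, sub_zero]
  let c : Fin m → ℝ := fun j => |log (∑ k, v k j)| + ∑ k, |log (v k j)|
  have hc : ∀ j, 0 ≤ c j := fun j => by positivity
  have hasymp : ∀ ξ i, |log (f ξ i) - ∑ j, H j i * μmax (G.mulVec ξ) j| ≤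
      ∑ i, ∑ j, |H j i| * c j := fun ξ i => by
    rw [hlogf, ← Finset.sum_sub_distrib]
    refine (Finset.abs_sum_le_sum_abs _ _).trans ?_
    refine le_trans (Finset.sum_le_sum fun j _ => ?_)
      (Finset.single_le_sum (f := fun i => ∑ j, |H j i| * c j)
        (fun i _ => Finset.sum_nonneg fun j _ => mul_nonneg (abs_nonneg _) (hc j))
        (Finset.mem_univ i))
    rw [← mul_sub, abs_mul]
    exact mul_le_mul_of_nonneg_left (hlse ξ j).2 (abs_nonneg _)
  rw [not_proper_iff_exists_zero_of_log_asymptotic hfc hfpos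
    (F := fun ξ i => ∑ j, H j i * μmax (G.mulVec ξ) j)
    (continuous_pi fun i => by fun_prop)
    (fun s hs ξ => by
      funext i
      simp only [Matrix.mulVec_smul, hμhom s hs, Pi.smul_apply, smul_eq_mul, Finset.mul_sum]
      exact Finset.sum_congr rfl fun j _ => by ring)
    hasymp]
  have hDperp_iff : ∀ u : Fin m → ℝ, u ∈ Dperp ↔ (fun i => ∑ j, H j i * u j) = 0 := fun u => by
    rw [hDperp]
    constructor
    · intro h
      funext i
      have hmem : H.mulVecLin (Pi.single i 1) ∈ D := hHrange ▸ LinearMap.mem_range_self _ _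
      simpa using h _ hmem
    · intro h z hz
      rw [← hHrange] at hz
      obtain ⟨x, rfl⟩ := hz
      have hu : Matrix.vecMul u H = 0 := by
        rw [← h]
        funext i
        simp [Matrix.vecMul, dotProduct, mul_comm]
      change H.mulVec x ⬝ᵥ u = 0
      rw [dotProduct_comm, Matrix.dotProduct_mulVec, hu, zero_dotProduct]
  have hGinj : Function.Injective G.mulVec := Matrix.mulVec_injective_iff.2 hGind
  constructor
  · rintro ⟨ξ, hξ, hF⟩
    refine ⟨G.mulVec ξ, hGrange ▸ LinearMap.mem_range_self G.mulVecLin ξ, fun h0 => hξ ?_,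
      (hDperp_iff _).2 hF⟩
    exact hGinj (h0.trans (Matrix.mulVec_zero G).symm)
  · rintro ⟨t, ht, ht0, htD⟩
    rw [← hGrange] at ht
    obtain ⟨ξ, rfl⟩ := ht
    exact ⟨ξ, fun h => ht0 (by simp [h]), (hDperp_iff _).1 htD⟩
end

section
/- If sign(T) ∩ sign(D^⊥) = {0}, i.e., there are no nonzero t ∈ T and u ∈ D^⊥ with sign(t_j) = sign(u_j) for all j ∈ {1,…,m}, then the map f is locally invertible, i.e., its derivative J_f(ξ) is injective for every ξ ∈ ℝ^{d_P}. -/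
open Matrix

/-- The exponentially weighted mean of the points `v k` with weights `exp (c k)`. -/
noncomputable def expMean {ι m : ℕ} (v : Fin ι → Fin m → ℝ) (c : Fin ι → ℝ) : Fin m → ℝ :=
  (∑ k, Real.exp (c k))⁻¹ • ∑ k, Real.exp (c k) • v k

lemma hasFDerivAt_expMean_comp {E : Type*} [NormedAddCommGroup E] [NormedSpace ℝ E]
    {ι m : ℕ} [NeZero ι] (v : Fin ι → Fin m → ℝ) (L : Fin ι → E →L[ℝ] ℝ) (x : E) :
    ∃ p' : E →L[ℝ] (Fin m → ℝ), HasFDerivAt (fun y => expMean v (fun k => L k y)) p' x ∧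
      ∀ h, p' h = (∑ k, Real.exp (L k x))⁻¹ •
        ∑ k, (Real.exp (L k x) * L k h) • (v k - expMean v (fun k => L k x)) := by
  have hpos : 0 < ∑ k, Real.exp (L k x) :=
    Finset.sum_pos (fun k _ => Real.exp_pos _) Finset.univ_nonempty
  have hw : ∀ k, HasFDerivAt (fun y => Real.exp (L k y)) (Real.exp (L k x) • L k) x :=
    fun k => (L k).hasFDerivAt.exp
  have hZ := HasFDerivAt.fun_sum (u := Finset.univ) (fun k _ => hw k)
  have hN := HasFDerivAt.fun_sum (u := Finset.univ) (fun k _ => (hw k).smul_const (v k))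
  have hZi := (hasDerivAt_inv hpos.ne').comp_hasFDerivAt x hZ
  refine ⟨_, hZi.smul hN, fun h => ?_⟩
  have key : expMean v (fun k => L k x) =
      (∑ k, Real.exp (L k x))⁻¹ • ∑ k, Real.exp (L k x) • v k := rfl
  simp only [smul_sub, Finset.sum_sub_distrib, ← Finset.sum_smul]
  rw [key]
  ext j
  simp [Finset.sum_apply]
  field_simp
  ring

lemma expMean_apply {ι m : ℕ} (v : Fin ι → Fin m → ℝ) (c : Fin ι → ℝ) (j : Fin m) :
    expMean v c j = (∑ k, Real.exp (c k))⁻¹ * ∑ k, Real.exp (c k) * v k j := by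
  simp [expMean, Finset.sum_apply]

/-- The weighted variance vanishes only if all values agree with the mean. -/
lemma dotProduct_eq_of_covariance_eq_zero {ι m : ℕ} [NeZero ι] (v : Fin ι → Fin m → ℝ)
    (c : Fin ι → ℝ) (t : Fin m → ℝ)
    (h : ∑ k, (Real.exp (c k) * v k ⬝ᵥ t) • (v k - expMean v c) = 0) (k : Fin ι) :
    v k ⬝ᵥ t = expMean v c ⬝ᵥ t := by
  have hpos : 0 < ∑ k, Real.exp (c k) :=
    Finset.sum_pos (fun k _ => Real.exp_pos _) Finset.univ_nonempty
  have hmean : expMean v c ⬝ᵥ t = (∑ k, Real.exp (c k))⁻¹ * ∑ k, Real.exp (c k) * v k ⬝ᵥ t := by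
    simp [expMean, sum_dotProduct]
  have h1 : ∑ k, Real.exp (c k) * (v k ⬝ᵥ t) * (v k ⬝ᵥ t - expMean v c ⬝ᵥ t) = 0 := by
    simpa [sum_dotProduct, sub_dotProduct] using congrArg (· ⬝ᵥ t) h
  have h2 : ∑ k, Real.exp (c k) * (v k ⬝ᵥ t - expMean v c ⬝ᵥ t) = 0 := by
    simp only [mul_sub, Finset.sum_sub_distrib, ← Finset.sum_mul]
    rw [hmean]
    field_simp
    ring
  have h3 : ∑ k, Real.exp (c k) * (v k ⬝ᵥ t - expMean v c ⬝ᵥ t) ^ 2 = 0 := by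
    calc _ = ∑ k, Real.exp (c k) * (v k ⬝ᵥ t) * (v k ⬝ᵥ t - expMean v c ⬝ᵥ t)
          - expMean v c ⬝ᵥ t * ∑ k, Real.exp (c k) * (v k ⬝ᵥ t - expMean v c ⬝ᵥ t) := by
          rw [Finset.mul_sum, ← Finset.sum_sub_distrib]
          exact Finset.sum_congr rfl fun k _ => by ring
      _ = 0 := by rw [h1, h2]; ring
  have h4 := (Finset.sum_eq_zero_iff_of_nonneg fun k _ => by positivity).1 h3 k (Finset.mem_univ k)
  have h5 := (mul_eq_zero.1 h4).resolve_left (Real.exp_ne_zero _)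
  linarith [pow_eq_zero_iff (two_ne_zero) |>.1 h5]

/-- A linear functional that is constant on the extreme points of a compact convex set is constant
on the whole set. -/
lemma dotProduct_eq_of_extremePoints {m : ℕ} {K : Set (Fin m → ℝ)} (hK : IsCompact K)
    (hconv : Convex ℝ K) (t : Fin m → ℝ) (r : ℝ)
    (h : ∀ y ∈ K.extremePoints ℝ, y ⬝ᵥ t = r) {y : Fin m → ℝ} (hy : y ∈ K) : y ⬝ᵥ t = r := by
  rw [← closure_convexHull_extremePoints hK hconv] at hy
  have hclosed : IsClosed {y : Fin m → ℝ | y ⬝ᵥ t = r} :=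
    isClosed_eq (by simp only [dotProduct]; fun_prop) continuous_const
  have hcvx : Convex ℝ {y : Fin m → ℝ | y ⬝ᵥ t = r} := by
    intro a ha b hb α β _ _ hαβ
    simp only [Set.mem_ofPred_eq] at ha hb ⊢
    rw [add_dotProduct, smul_dotProduct, smul_dotProduct, ha, hb, ← add_smul, hαβ, one_smul]
  exact closure_minimal (convexHull_min h hcvx) hclosed hy

/-- The nonnegative solutions of `A y = 0` with coordinate sum one form a compact convex set. -/
lemma isCompact_convex_kernel_simplex {l m : ℕ} (A : Matrix (Fin l) (Fin m) ℝ) :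
    IsCompact {y : Fin m → ℝ | A.mulVec y = 0 ∧ (∀ j, 0 ≤ y j) ∧ ∑ j, y j = 1} ∧
      Convex ℝ {y : Fin m → ℝ | A.mulVec y = 0 ∧ (∀ j, 0 ≤ y j) ∧ ∑ j, y j = 1} := by
  have heq : {y : Fin m → ℝ | A.mulVec y = 0 ∧ (∀ j, 0 ≤ y j) ∧ ∑ j, y j = 1} =
      stdSimplex ℝ (Fin m) ∩ (LinearMap.ker A.mulVecLin : Set (Fin m → ℝ)) := by
    ext y
    simp [stdSimplex, and_comm]
  rw [heq]
  exact ⟨(isCompact_stdSimplex ℝ (Fin m)).inter_right (Submodule.closed_of_finiteDimensional _),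
    (convex_stdSimplex ℝ (Fin m)).inter (Submodule.convex _)⟩

lemma hasFDerivAt_prod_rpow {E : Type*} [NormedAddCommGroup E] [NormedSpace ℝ E] {m d : ℕ}
    {p : E → Fin m → ℝ} {p' : E →L[ℝ] (Fin m → ℝ)} {x : E} (hp : HasFDerivAt p p' x)
    (hpos : ∀ j, 0 < p x j) (H : Matrix (Fin m) (Fin d) ℝ) :
    ∃ f' : E →L[ℝ] (Fin d → ℝ),
      HasFDerivAt (fun y => fun i => ∏ j, Real.rpow (p y j) (H j i)) f' x ∧
      ∀ h i, f' h i = (∏ j, Real.rpow (p x j) (H j i)) * ∑ j, H j i * (p' h j / p x j) := by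
  have hj : ∀ j, HasFDerivAt (fun y => p y j) ((ContinuousLinearMap.proj j).comp p') x :=
    fun j => hasFDerivAt_pi'.1 hp j
  have hr := fun i j => (hj j).rpow_const (p := H j i) (Or.inl (hpos j).ne')
  refine ⟨_, hasFDerivAt_pi.2 fun i =>
    HasFDerivAt.finsetProd (u := Finset.univ) (fun j _ => hr i j), fun h i => ?_⟩
  simp only [ContinuousLinearMap.coe_pi', _root_.sum_apply,
    _root_.smul_apply, ContinuousLinearMap.comp_apply, ContinuousLinearMap.proj_apply,
    smul_eq_mul, Real.rpow_eq_pow, Finset.mul_sum]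
  refine Finset.sum_congr rfl fun j _ => ?_
  rw [← Finset.mul_prod_erase Finset.univ _ (Finset.mem_univ j), Real.rpow_sub_one (hpos j).ne']
  ring


/-- if sign(T) ∩ sign(D⊥) = {0} then the derivative of f is injective everywhere. -/
theorem sign_condition_implies_local_invertibility
    (l m n dP d nP : ℕ)
    (A : Matrix (Fin l) (Fin m) ℝ) (B : Matrix (Fin n) (Fin m) ℝ)
    (T D : Submodule ℝ (Fin m → ℝ))
    (hT : ∀ y : Fin m → ℝ, y ∈ T ↔ (A.mulVec y = 0 ∧ ∑ j, y j = 0))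
    (hD : ∀ y : Fin m → ℝ, y ∈ D ↔ (B.mulVec y = 0 ∧ ∑ j, y j = 0))
    (hdP : Module.finrank ℝ T = dP) (hd : Module.finrank ℝ D = d) (hdPd : dP = d)
    (G : Matrix (Fin m) (Fin dP) ℝ) (H : Matrix (Fin m) (Fin d) ℝ)
    (hGind : LinearIndependent ℝ (fun i : Fin dP => fun j => G j i))
    (hGrange : LinearMap.range G.mulVecLin = T)
    (hHind : LinearIndependent ℝ (fun i : Fin d => fun j => H j i))
    (hHrange : LinearMap.range H.mulVecLin = D)
    (Dperp : Set (Fin m → ℝ))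
    (hDperp : Dperp = {u : Fin m → ℝ | ∀ z ∈ D, ∑ j, z j * u j = 0})
    (P : Set (Fin m → ℝ))
    (hP : P = {y : Fin m → ℝ | A.mulVec y = 0 ∧ (∀ j, 0 < y j) ∧ ∑ j, y j = 1})
    (hPne : P.Nonempty)
    (Pbar : Set (Fin m → ℝ))
    (hPbar : Pbar = {y : Fin m → ℝ | A.mulVec y = 0 ∧ (∀ j, 0 ≤ y j) ∧ ∑ j, y j = 1})
    (v : Fin nP → (Fin m → ℝ))
    (hv : Set.range v = Set.extremePoints ℝ Pbar)
    (p : (Fin dP → ℝ) → (Fin m → ℝ))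
    (hp : ∀ ξ, p ξ = (∑ k, Real.exp (∑ j, v k j * G.mulVec ξ j))⁻¹ •
        ∑ k, Real.exp (∑ j, v k j * G.mulVec ξ j) • v k)
    (f : (Fin dP → ℝ) → (Fin d → ℝ))
    (hf : ∀ ξ, f ξ = fun i => ∏ j, Real.rpow (p ξ j) (H j i))
    :
    (¬ ∃ t ∈ T, ∃ u ∈ Dperp, t ≠ 0 ∧ u ≠ 0 ∧
        ∀ j, Real.sign (t j) = Real.sign (u j)) →
      ∀ ξ : Fin dP → ℝ, Function.Injective (fderiv ℝ f ξ) := by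
  intro hsign ξ
  subst hPbar hP hDperp
  obtain ⟨y₀, hy₀A, hy₀pos, hy₀sum⟩ := hPne
  obtain ⟨hcomp, hconv⟩ := isCompact_convex_kernel_simplex A
  have hvmem : ∀ k, A.mulVec (v k) = 0 ∧ (∀ j, 0 ≤ v k j) ∧ ∑ j, v k j = 1 := fun k => by
    have hk := Set.mem_range_self (f := v) k
    rw [hv] at hk
    have hmem := extremePoints_subset hk
    exact hmem
  have hconst : ∀ (t : Fin m → ℝ) (r : ℝ), (∀ k, v k ⬝ᵥ t = r) →
      ∀ y : Fin m → ℝ, A.mulVec y = 0 → (∀ j, 0 ≤ y j) → ∑ j, y j = 1 → y ⬝ᵥ t = r := by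
    intro t r h y h1 h2 h3
    refine dotProduct_eq_of_extremePoints hcomp hconv t r ?_ ⟨h1, h2, h3⟩
    rw [← hv]
    rintro _ ⟨k, rfl⟩
    exact h k
  have hy₀nn : ∀ j, 0 ≤ y₀ j := fun j => (hy₀pos j).le
  have : NeZero nP := by
    refine ⟨?_⟩
    rintro rfl
    have := hconst 0 1 (fun k => k.elim0) y₀ hy₀A hy₀nn hy₀sum
    simp at this
  let L : Fin nP → (Fin dP → ℝ) →L[ℝ] ℝ := fun k =>
    LinearMap.toContinuousLinearMap ((dotProductBilin ℝ ℝ (v k)).comp G.mulVecLin)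
  have hpL : p = fun ξ => expMean v (fun k => L k ξ) := funext hp
  obtain ⟨p', hp', hp'eq⟩ := hasFDerivAt_expMean_comp v L ξ
  rw [← hpL] at hp'
  have hpξ : expMean v (fun k => L k ξ) = p ξ := by rw [hpL]
  have hZ : 0 < ∑ k, Real.exp (L k ξ) :=
    Finset.sum_pos (fun k _ => Real.exp_pos _) Finset.univ_nonempty
  have hppos : ∀ j, 0 < p ξ j := by
    intro j
    rw [← hpξ, expMean_apply]
    refine mul_pos (inv_pos.2 hZ) ?_
    have hnn : ∀ k ∈ Finset.univ, 0 ≤ Real.exp (L k ξ) * v k j := fun k _ =>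
      mul_nonneg (Real.exp_pos _).le ((hvmem k).2.1 j)
    refine lt_of_le_of_ne (Finset.sum_nonneg hnn) fun h0 => ?_
    have hz := (Finset.sum_eq_zero_iff_of_nonneg hnn).1 h0.symm
    have := hconst (Pi.single j 1) 0 (fun k => by
      simpa [Real.exp_ne_zero] using hz k (Finset.mem_univ k)) y₀ hy₀A hy₀nn hy₀sum
    simp at this
    exact (hy₀pos j).ne' this
  obtain ⟨f', hf', hf'eq⟩ := hasFDerivAt_prod_rpow hp' hppos H
  rw [← funext hf] at hf'
  rw [hf'.fderiv]
  refine (injective_iff_map_eq_zero f').2 fun η hη => ?_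
  have hpT : A.mulVec (p ξ) = 0 ∧ ∑ j, p ξ j = 1 := by
    constructor
    · rw [← hpξ]
      simp [expMean, mulVec_smul, mulVec_sum, (hvmem _).1]
    · rw [← hpξ]
      simp only [expMean_apply]
      rw [← Finset.mul_sum, Finset.sum_comm]
      simp only [← Finset.mul_sum, (hvmem _).2.2, mul_one]
      exact inv_mul_cancel₀ hZ.ne'
  have hvT : ∀ k, v k - p ξ ∈ T := fun k => (hT _).2 ⟨by
    rw [mulVec_sub, (hvmem k).1, hpT.1, sub_zero], by
    simp [Finset.sum_sub_distrib, (hvmem k).2.2, hpT.2]⟩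
  have hdT : p' η ∈ T := by
    rw [hp'eq, hpξ]
    exact T.smul_mem _ (T.sum_mem fun k _ => T.smul_mem _ (hvT k))
  have hd0 : p' η = 0 := by
    by_contra hne
    refine hsign ⟨p' η, hdT, fun j => p' η j / p ξ j, ?_, hne, ?_, ?_⟩
    · intro z hz
      rw [← hHrange] at hz
      obtain ⟨a, rfl⟩ := hz
      have h0 : ∀ i, ∑ j, H j i * (p' η j / p ξ j) = 0 := by
        intro i
        have h1 := hf'eq η i
        rw [hη] at h1
        exact (mul_eq_zero.1 h1.symm).resolve_left
          (Finset.prod_pos fun j _ => Real.rpow_pos_of_pos (hppos j) _).ne'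
      change H.mulVec a ⬝ᵥ (fun j => p' η j / p ξ j) = 0
      rw [dotProduct_comm, dotProduct_mulVec]
      have : (fun j => p' η j / p ξ j) ᵥ* H = 0 := by
        ext i
        refine Eq.trans ?_ (h0 i)
        simp only [vecMul, dotProduct, mul_comm]
      rw [this, zero_dotProduct]
    · intro h
      refine hne (funext fun j => ?_)
      simpa [(hppos j).ne'] using congrFun h j
    · intro j
      rcases lt_trichotomy (p' η j) 0 with h | h | h
      · rw [Real.sign_of_neg h, Real.sign_of_neg (div_neg_of_neg_of_pos h (hppos j))]
      · simp [h]
      · rw [Real.sign_of_pos h, Real.sign_of_pos (div_pos h (hppos j))]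
  have hcov := (smul_eq_zero.1 ((hp'eq η).symm.trans hd0)).resolve_left (inv_pos.2 hZ).ne'
  have hk := dotProduct_eq_of_covariance_eq_zero v (fun k => L k ξ) (G.mulVec η) hcov
  have htT : G.mulVec η ∈ T := hGrange ▸ LinearMap.mem_range_self G.mulVecLin η
  obtain ⟨htA, htsum⟩ := (hT _).1 htT
  have hev : ∀ᶠ ε in nhdsWithin (0 : ℝ) (Set.Ioi 0), ∀ j, 0 ≤ (y₀ + ε • G.mulVec η) j := by
    refine Filter.eventually_all.2 fun j => nhdsWithin_le_nhds ?_
    have hc : ContinuousAt (fun ε : ℝ => (y₀ + ε • G.mulVec η) j) 0 := by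
      simp only [Pi.add_apply, Pi.smul_apply]
      fun_prop
    exact (hc.eventually_const_lt (by simpa using hy₀pos j)).mono fun _ => le_of_lt
  obtain ⟨ε, hεnn, hε⟩ := (hev.and self_mem_nhdsWithin).exists
  have h1 := hconst _ _ hk y₀ hy₀A hy₀nn hy₀sum
  have h2 := hconst _ _ hk (y₀ + ε • G.mulVec η)
    (by rw [mulVec_add, mulVec_smul, hy₀A, htA]; simp) hεnn
    (by simp [Finset.sum_add_distrib, ← Finset.mul_sum, hy₀sum, htsum])
  rw [add_dotProduct, h1, smul_dotProduct, add_eq_left, smul_eq_zero] at h2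
  have h3 := dotProduct_self_eq_zero.1 (h2.resolve_left (ne_of_gt hε))
  exact Matrix.mulVec_injective_iff.2 hGind (h3.trans (mulVec_zero G).symm)
end

section
/- Let t ∈ T be nonzero and let F = {x ∈ P̄ : x·t = max_{y ∈ P̄} y·t} be the face of P̄ on which the linear functional x ↦ t·x attains its maximum. Set μ* = max_{1≤j≤m} μ_j^max(t) and δμ_j^max(t) = μ_j^max(t) − μ*. Then for every j ∈ {1,…,m}: (i) δμ_j^max(t) < 0 if x_j = 0 for all x ∈ F; and (ii) δμ_j^max(t) = 0 otherwise. -/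
/-- A continuous linear functional that does not vanish identically on a compact exposed face does
not vanish at some extreme point of the ambient set lying in that face. -/
theorem IsExposed.exists_extremePoint_ne_zero {E : Type*} [AddCommGroup E] [Module ℝ E]
    [TopologicalSpace E] [T2Space E] [IsTopologicalAddGroup E] [ContinuousSMul ℝ E]
    [LocallyConvexSpace ℝ E] {K F : Set E} (hKF : IsExposed ℝ K F) (hFc : IsCompact F)
    (hFconv : Convex ℝ F) (g : E →L[ℝ] ℝ) {x : E} (hx : x ∈ F) (hgx : g x ≠ 0) :
    ∃ w ∈ K.extremePoints ℝ, w ∈ F ∧ g w ≠ 0 := by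
  by_contra! h
  have hsub : F.extremePoints ℝ ⊆ {y | g y = 0} := fun w hw ↦
    h w (hKF.isExtreme.extremePoints_subset_extremePoints hw) (extremePoints_subset hw)
  have hconv : Convex ℝ {y | g y = 0} := convex_hyperplane g.toLinearMap.isLinear 0
  have hclosed : IsClosed {y | g y = 0} := isClosed_eq g.continuous continuous_const
  rw [← closure_convexHull_extremePoints hFc hFconv] at hx
  exact hgx (closure_minimal (convexHull_min hsub hconv) hclosed hx)

/-- The solutions of a homogeneous linear system in the standard simplex form a compact set. -/
theorem isCompact_setOf_mulVec_eq_zero_inter_stdSimplex {ι κ : Type*} [Fintype ι]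
    (A : Matrix κ ι ℝ) :
    IsCompact {y : ι → ℝ | A.mulVec y = 0 ∧ (∀ j, 0 ≤ y j) ∧ ∑ j, y j = 1} :=
  (isCompact_stdSimplex ℝ ι).inter_left
    (isClosed_eq (Continuous.matrix_mulVec continuous_const continuous_id) continuous_const)

/-- The solutions of a homogeneous linear system in the standard simplex form a convex set. -/
theorem convex_setOf_mulVec_eq_zero_inter_stdSimplex {ι κ : Type*} [Fintype ι]
    (A : Matrix κ ι ℝ) :
    Convex ℝ {y : ι → ℝ | A.mulVec y = 0 ∧ (∀ j, 0 ≤ y j) ∧ ∑ j, y j = 1} :=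
  (convex_hyperplane (𝕜 := ℝ) A.mulVecLin.isLinear 0).inter (convex_stdSimplex ℝ ι)


/-- on the face F of P̄ maximizing x ↦ t·x, δμⱼᵐᵃˣ(t) < 0 exactly for the coordinates vanishing on F, and = 0 otherwise. -/
theorem sign_mu_on_faces
    (l m n dP d nP : ℕ)
    (A : Matrix (Fin l) (Fin m) ℝ) (B : Matrix (Fin n) (Fin m) ℝ)
    (T D : Submodule ℝ (Fin m → ℝ))
    (hT : ∀ y : Fin m → ℝ, y ∈ T ↔ (A.mulVec y = 0 ∧ ∑ j, y j = 0))
    (hD : ∀ y : Fin m → ℝ, y ∈ D ↔ (B.mulVec y = 0 ∧ ∑ j, y j = 0))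
    (hdP : Module.finrank ℝ T = dP) (hd : Module.finrank ℝ D = d) (hdPd : dP = d)
    (P : Set (Fin m → ℝ))
    (hP : P = {y : Fin m → ℝ | A.mulVec y = 0 ∧ (∀ j, 0 < y j) ∧ ∑ j, y j = 1})
    (hPne : P.Nonempty)
    (Pbar : Set (Fin m → ℝ))
    (hPbar : Pbar = {y : Fin m → ℝ | A.mulVec y = 0 ∧ (∀ j, 0 ≤ y j) ∧ ∑ j, y j = 1})
    (v : Fin nP → (Fin m → ℝ))
    (hv : Set.range v = Set.extremePoints ℝ Pbar)
    (μmax : (Fin m → ℝ) → (Fin m → ℝ))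
    (hμ : ∀ (t : Fin m → ℝ) (j : Fin m),
      IsGreatest {x : ℝ | ∃ k, v k j ≠ 0 ∧ x = ∑ j', v k j' * t j'} (μmax t j))
    (t : Fin m → ℝ) (htT : t ∈ T) (ht0 : t ≠ 0)
    (F : Set (Fin m → ℝ))
    (hF : F = {x ∈ Pbar | ∀ y ∈ Pbar, ∑ j, y j * t j ≤ ∑ j, x j * t j})
    (μstar : ℝ) (hμstar : IsGreatest (Set.range fun j => μmax t j) μstar)
    :
    ∀ j : Fin m,
      ((∀ x ∈ F, x j = 0) → μmax t j - μstar < 0) ∧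
      (¬ (∀ x ∈ F, x j = 0) → μmax t j - μstar = 0) := by
  have hK : IsCompact Pbar := hPbar ▸ isCompact_setOf_mulVec_eq_zero_inter_stdSimplex A
  have hKconv : Convex ℝ Pbar := hPbar ▸ convex_setOf_mulVec_eq_zero_inter_stdSimplex A
  have hKne : Pbar.Nonempty := by
    obtain ⟨y, hy⟩ := hPne
    rw [hP] at hy
    exact ⟨y, hPbar ▸ ⟨hy.1, fun j ↦ (hy.2.1 j).le, hy.2.2⟩⟩
  let f : (Fin m → ℝ) →L[ℝ] ℝ := ∑ j, t j • ContinuousLinearMap.proj j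
  have hf : ∀ x, f x = ∑ j, x j * t j := fun x ↦ by simp [f, mul_comm]
  have hFexp : IsExposed ℝ Pbar F := fun _ ↦ ⟨f, by simp only [hF, hf]⟩
  have hvK : ∀ k, v k ∈ Pbar := fun k ↦
    extremePoints_subset (hv ▸ Set.mem_range_self k : v k ∈ Pbar.extremePoints ℝ)
  obtain ⟨x₀, hx₀, hmax⟩ := hK.exists_isMaxOn hKne f.continuous.continuousOn
  have hle : ∀ y ∈ Pbar, ∑ j, y j * t j ≤ ∑ j, x₀ j * t j := fun y hy ↦ by
    simpa only [hf] using isMaxOn_iff.mp hmax y hy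
  have hx₀F : x₀ ∈ F := by
    rw [hF]
    exact ⟨hx₀, hle⟩
  have hμle : ∀ j, μmax t j ≤ ∑ j, x₀ j * t j := fun j ↦ by
    obtain ⟨k, -, hk⟩ := (hμ t j).1
    exact hk ▸ hle _ (hvK k)
  have hμeq : ∀ j, ∀ x ∈ F, x j ≠ 0 → μmax t j = ∑ j, x₀ j * t j := fun j x hx hxj ↦ by
    obtain ⟨w, hw, hwF, hwj⟩ := hFexp.exists_extremePoint_ne_zero (hFexp.isCompact hK)
      (hFexp.convex hKconv) (ContinuousLinearMap.proj j) hx hxj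
    rw [← hv] at hw
    obtain ⟨k, rfl⟩ := hw
    rw [hF] at hwF
    exact (hμle j).antisymm ((hwF.2 x₀ hx₀).trans ((hμ t j).2 ⟨k, hwj, rfl⟩))
  have hstar : μstar = ∑ j, x₀ j * t j := by
    have hsum : ∑ j, x₀ j = 1 := by
      rw [hPbar] at hx₀
      exact hx₀.2.2
    obtain ⟨i, -, hi⟩ := Finset.exists_ne_zero_of_sum_ne_zero (hsum.trans_ne one_ne_zero)
    obtain ⟨j, hj⟩ := hμstar.1
    exact (hj.symm.trans_le (hμle j)).antisymm (hμeq i x₀ hx₀F hi ▸ hμstar.2 ⟨i, rfl⟩)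
  intro j
  constructor
  · intro hzero
    refine sub_neg.mpr (lt_of_le_of_ne (hstar ▸ hμle j) fun heq ↦ ?_)
    obtain ⟨k, hkj, hk⟩ := (hμ t j).1
    refine hkj (hzero (v k) ?_)
    rw [hF]
    exact ⟨hvK k, fun y hy ↦ (hle y hy).trans_eq (hstar.symm.trans (heq.symm.trans hk))⟩
  · intro hne
    push Not at hne
    obtain ⟨x, hx, hxj⟩ := hne
    rw [hμeq j x hx hxj, hstar, sub_self]
end
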